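/- arXiv:1205.6847 — 4 statements merged into one kernel-verified Lean document; each statement's English description precedes it below -/
import Mathlib

section
/- For all integers s ≥ 1 and n ≥ 3s+2, every family 𝓕 of 3-element subsets of [n] with matching number ν(𝓕) = s satisfies |𝓕| ≤ max{ C(3s+2,3), C(n,3) − C(n−s,3) }. -/
/-- The matching number of a family of finite sets: the maximum number of
pairwise disjoint nonempty members. -/
noncomputable def matchNum (𝓕 : Finset (Finset ℕ)) : ℕ :=
  sSup {m | ∃ M ⊆ 𝓕, M.card = m ∧ (∀ A ∈ M, A.Nonempty) ∧
    (M : Set (Finset ℕ)).Pairwise fun A B => Disjoint A B}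

/-- A family of subsets of `[n] = {1,…,n}` is stable if it is closed downwards
under the "shifting" partial order: whenever `F ∈ 𝓕` and `G ⊆ [n]` admits a
bijection `φ : F → G` with `φ x ≤ x` for all `x ∈ F`, then `G ∈ 𝓕`. -/
def Stable (n : ℕ) (𝓕 : Finset (Finset ℕ)) : Prop :=
  ∀ F ∈ 𝓕, ∀ G : Finset ℕ, G ⊆ Finset.Icc 1 n → G.card = F.card →
    (∃ φ : ℕ → ℕ, Set.BijOn φ (F : Set ℕ) (G : Set ℕ) ∧ ∀ x ∈ F, φ x ≤ x) → G ∈ 𝓕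

/-- A family of `k`-element subsets of `[n]` is saturated if adding any new
`k`-element subset of `[n]` increases the matching number. -/
def Saturated (n k : ℕ) (𝓕 : Finset (Finset ℕ)) : Prop :=
  ∀ E : Finset ℕ, E ⊆ Finset.Icc 1 n → E.card = k → E ∉ 𝓕 →
    matchNum 𝓕 < matchNum (insert E 𝓕)

/-- The family `E` contains `p` pairwise disjoint members. -/
def HasMatching (E : Finset (Finset ℕ)) (p : ℕ) : Prop :=
  ∃ f : Fin p → Finset ℕ, (∀ i, f i ∈ E) ∧ Pairwise fun i j => Disjoint (f i) (f j)

theorem HasMatching.of_fintype {E : Finset (Finset ℕ)} {p : ℕ} {ι : Type} [Fintype ι]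
    (f : ι → Finset ℕ) (hE : ∀ i, f i ∈ E) (hf : Pairwise fun i j => Disjoint (f i) (f j))
    (hp : p ≤ Fintype.card ι) : HasMatching E p := by
  let e : Fin p → ι := fun i => (Fintype.equivFin ι).symm (Fin.castLE hp i)
  have he : Function.Injective e := fun i j h => by
    simpa [e] using h
  exact ⟨fun i => f (e i), fun i => hE _, fun i j hij => hf (he.ne hij)⟩

theorem HasMatching.of_option {E : Finset (Finset ℕ)} {p : ℕ} {ι : Type} [Fintype ι]
    (f : ι → Finset ℕ) (hE : ∀ i, f i ∈ E) (hf : Pairwise fun i j => Disjoint (f i) (f j))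
    {A : Finset ℕ} (hA : A ∈ E) (hd : ∀ i, Disjoint A (f i)) (hp : p ≤ Fintype.card ι + 1) :
    HasMatching E p := by
  refine HasMatching.of_fintype (fun o : Option ι => o.elim A f) ?_ ?_ (by simpa using hp)
  · rintro (_ | i)
    · exact hA
    · exact hE i
  · rintro (_ | i) (_ | j) h
    · exact absurd rfl h
    · exact hd j
    · exact (hd i).symm
    · exact hf (by simpa using h)

theorem hasMatching_one {E : Finset (Finset ℕ)} {A : Finset ℕ} (hA : A ∈ E) :
    HasMatching E 1 :=
  ⟨fun _ => A, fun _ => hA, fun i j hij => absurd (Subsingleton.elim i j) hij⟩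

theorem card_biUnion_matching {ι : Type} [Fintype ι] (f : ι → Finset ℕ) (k : ℕ)
    (hc : ∀ i, (f i).card = k) (hf : Pairwise fun i j => Disjoint (f i) (f j)) :
    (Finset.univ.biUnion f).card = Fintype.card ι * k := by
  rw [Finset.card_biUnion fun i _ j _ hij => hf hij]
  simp [hc]

/-- A family of pairs inside `W` that is closed under replacing an element of a pair by a
smaller element of `W`. -/
def PairStable (Q : Finset (Finset ℕ)) (W : Finset ℕ) : Prop :=
  ∀ x ∈ W, ∀ y ∈ W, ∀ z ∈ W, x ≠ y → z ≠ y → z < x → {x, y} ∈ Q → {z, y} ∈ Q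

theorem mem_powersetCard_two {W A : Finset ℕ} (h : A ∈ W.powersetCard 2) :
    ∃ x y, x < y ∧ x ∈ W ∧ y ∈ W ∧ A = {x, y} := by
  rw [Finset.mem_powersetCard] at h
  obtain ⟨x, y, hxy, rfl⟩ := Finset.card_eq_two.1 h.2
  have hx : x ∈ W := h.1 (by simp)
  have hy : y ∈ W := h.1 (by simp)
  rcases lt_or_gt_of_ne hxy with h' | h'
  · exact ⟨x, y, h', hx, hy, rfl⟩
  · exact ⟨y, x, h', hy, hx, Finset.pair_comm x y⟩

theorem pair_mem_powersetCard {W : Finset ℕ} {x y : ℕ} :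
    ({x, y} : Finset ℕ) ∈ W.powersetCard 2 ↔ x ≠ y ∧ x ∈ W ∧ y ∈ W := by
  rw [Finset.mem_powersetCard]
  constructor
  · rintro ⟨h1, h2⟩
    refine ⟨?_, h1 (by simp), h1 (by simp)⟩
    rintro rfl
    simp at h2
  · rintro ⟨h, hx, hy⟩
    refine ⟨?_, Finset.card_pair h⟩
    intro a ha
    simp only [Finset.mem_insert, Finset.mem_singleton] at ha
    rcases ha with rfl | rfl <;> assumption

/-- Erdős–Gallai bound for stable graphs. -/
theorem card_le_of_pairStable (r : ℕ) : ∀ (W : Finset ℕ) (Q : Finset (Finset ℕ)),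
    Q ⊆ W.powersetCard 2 → PairStable Q W → ¬ HasMatching Q (r + 1) →
    ∃ i j, i + j = r ∧ 2 * Q.card + i * (i + 1) ≤ 2 * i * W.card + (2 * j + 1) * (2 * j) := by
  induction r with
  | zero =>
    intro W Q _ _ hM
    refine ⟨0, 0, rfl, ?_⟩
    have : Q = ∅ := Finset.eq_empty_of_forall_notMem fun A hA => hM (hasMatching_one hA)
    simp [this]
  | succ r ih =>
    intro W Q hQ hst hM
    rcases W.eq_empty_or_nonempty with rfl | hW
    · refine ⟨0, r + 1, by omega, ?_⟩
      have : Q = ∅ := by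
        rw [Finset.eq_empty_iff_forall_notMem]
        intro A hA
        obtain ⟨x, _, _, hx, _⟩ := mem_powersetCard_two (hQ hA)
        simp at hx
      simp [this]
    set w := W.min' hW with hw
    have hwW : w ∈ W := W.min'_mem hW
    have hwle : ∀ x ∈ W, x ≠ w → w < x := fun x hx hne =>
      lt_of_le_of_ne (W.min'_le x hx) (Ne.symm hne)
    set Nb := W.filter (fun y => y ≠ w ∧ {w, y} ∈ Q) with hNb
    by_cases hcard : Nb.card ≤ 2 * (r + 1)
    · refine ⟨0, r + 1, by omega, ?_⟩
      have hsub : Q ⊆ (insert w Nb).powersetCard 2 := by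
        intro A hA
        obtain ⟨x, y, hxy, hx, hy, rfl⟩ := mem_powersetCard_two (hQ hA)
        rw [pair_mem_powersetCard]
        have hyw : y ≠ w := by
          rintro rfl
          exact absurd (W.min'_le x hx) (by omega)
        refine ⟨hxy.ne, ?_, ?_⟩
        · by_cases hxw : x = w
          · simp [hxw]
          · refine Finset.mem_insert_of_mem (Finset.mem_filter.2 ⟨hx, hxw, ?_⟩)
            exact hst y hy x hx w hwW hxy.ne' (Ne.symm hxw) (hwle y hy hyw)
              (by rwa [Finset.pair_comm])
        · refine Finset.mem_insert_of_mem (Finset.mem_filter.2 ⟨hy, hyw, ?_⟩)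
          by_cases hxw : x = w
          · rwa [← hxw]
          · exact hst x hx y hy w hwW hxy.ne hyw.symm (hwle x hx hxw) hA
      have h1 := Finset.card_le_card hsub
      rw [Finset.card_powersetCard] at h1
      have h2 : (insert w Nb).card ≤ 2 * (r + 1) + 1 :=
        (Finset.card_insert_le _ _).trans (by omega)
      have h3 := h1.trans (Nat.choose_le_choose 2 h2)
      rw [Nat.choose_two_right, Nat.le_div_iff_mul_le (by norm_num)] at h3
      simp only [Nat.add_sub_cancel] at h3
      omega
    · have hQ' : ∀ A ∈ Q.filter (fun A => w ∉ A), A ∈ (W.erase w).powersetCard 2 := by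
        intro A hA
        rw [Finset.mem_filter] at hA
        obtain ⟨x, y, hxy, hx, hy, rfl⟩ := mem_powersetCard_two (hQ hA.1)
        simp only [Finset.mem_insert, Finset.mem_singleton, not_or] at hA
        rw [pair_mem_powersetCard, Finset.mem_erase, Finset.mem_erase]
        exact ⟨hxy.ne, ⟨Ne.symm hA.2.1, hx⟩, ⟨Ne.symm hA.2.2, hy⟩⟩
      obtain ⟨i, j, hij, hle⟩ := ih (W.erase w) (Q.filter fun A => w ∉ A) hQ' (by
          intro x hx y hy z hz hxy hzy hzx h
          rw [Finset.mem_erase] at hx hy hz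
          rw [Finset.mem_filter] at h ⊢
          refine ⟨hst x hx.2 y hy.2 z hz.2 hxy hzy hzx h.1, ?_⟩
          simp [Ne.symm hz.1, Ne.symm hy.1]) (by
          rintro ⟨f, hf, hd⟩
          have hc : (Finset.univ.biUnion f).card = (r + 1) * 2 := by
            rw [card_biUnion_matching f 2 (fun i => (Finset.mem_powersetCard.1 (hQ' _ (hf i))).2) hd]
            simp
          obtain ⟨u, hu, hu'⟩ := Finset.exists_mem_notMem_of_card_lt_card
            (s := Finset.univ.biUnion f) (t := Nb) (by omega)
          rw [Finset.mem_filter] at hu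
          refine hM (HasMatching.of_option f (fun i => (Finset.mem_filter.1 (hf i)).1) hd hu.2.2
            (fun i => ?_) (by simp))
          rw [Finset.disjoint_left]
          intro a ha hai
          simp only [Finset.mem_insert, Finset.mem_singleton] at ha
          rcases ha with rfl | rfl
          · exact (Finset.mem_filter.1 (hf i)).2 hai
          · exact hu' (Finset.mem_biUnion.2 ⟨i, Finset.mem_univ _, hai⟩))
      rw [Finset.card_erase_of_mem hwW] at hle
      have hcw : 1 ≤ W.card := Finset.card_pos.2 hW
      have hstar : (Q.filter fun A => ¬ w ∉ A).card ≤ W.card - 1 := by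
        rw [← Finset.card_erase_of_mem hwW]
        refine (Finset.card_le_card (t := (W.erase w).image fun y => ({w, y} : Finset ℕ)) ?_).trans
          Finset.card_image_le
        intro A hA
        rw [Finset.mem_filter, not_not] at hA
        obtain ⟨x, y, hxy, hx, hy, rfl⟩ := mem_powersetCard_two (hQ hA.1)
        simp only [Finset.mem_insert, Finset.mem_singleton] at hA
        rw [Finset.mem_image]
        rcases hA.2 with h | h
        · exact ⟨y, Finset.mem_erase.2 ⟨by omega, hy⟩, by rw [h]⟩
        · exact ⟨x, Finset.mem_erase.2 ⟨by omega, hx⟩, by rw [h, Finset.pair_comm]⟩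
      have hsum := Finset.card_filter_add_card_filter_not (s := Q) (fun A => w ∉ A)
      refine ⟨i + 1, j, by omega, ?_⟩
      obtain ⟨c, hc⟩ : ∃ c, W.card = c + 1 := ⟨W.card - 1, by omega⟩
      rw [hc] at hle hstar ⊢
      simp only [Nat.add_sub_cancel] at hle hstar
      nlinarith

/-- The family `E` is closed under replacing an element of a member by a smaller positive one. -/
def Shifted (E : Finset (Finset ℕ)) : Prop :=
  ∀ A x y, x ∉ A → y ∉ A → 1 ≤ y → y ≤ x → insert x A ∈ E → insert y A ∈ E

theorem Shifted.triple {E : Finset (Finset ℕ)} (hE : Shifted E) {x y z x' y' z' : ℕ}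
    (hx : 1 ≤ x') (hxy : x < y) (hyz : y < z) (hxy' : x' < y') (hyz' : y' < z')
    (h1 : x' ≤ x) (h2 : y' ≤ y) (h3 : z' ≤ z) (h : ({z, x, y} : Finset ℕ) ∈ E) :
    ({z', x', y'} : Finset ℕ) ∈ E := by
  have e1 : ({z, x, y} : Finset ℕ) = insert x {y, z} := by grind
  have e2 : ({x', y, z} : Finset ℕ) = insert y {x', z} := by grind
  have e3 : ({y', x', z} : Finset ℕ) = insert z {x', y'} := by grind
  rw [e1] at h
  have h := hE _ x x' (by simp; omega) (by simp; omega) hx h1 h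
  rw [e2] at h
  have h := hE _ y y' (by simp; omega) (by simp; omega) (by omega) h2 h
  rw [e3] at h
  exact hE _ z z' (by simp; omega) (by simp; omega) (by omega) h3 h

theorem exists_injective_mem (ι : Type) [Fintype ι] (Y : Finset ℕ) (h : Fintype.card ι ≤ Y.card) :
    ∃ c : ι → ℕ, Function.Injective c ∧ ∀ i, c i ∈ Y := by
  obtain ⟨e⟩ := Function.Embedding.nonempty_of_card_le (α := ι) (β := Y) (by simpa using h)
  exact ⟨fun i => (e i : ℕ), Subtype.val_injective.comp e.injective, fun i => (e i).2⟩

/-- Completing disjoint pairs to a matching: the pairs `P i` can be completed by every vertex of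
`V`, the pairs `Q j` by every vertex of `X`. -/
theorem hasMatching_of_pairs {E : Finset (Finset ℕ)} {ι κ : Type} [Fintype ι] [Fintype κ]
    (P : ι → Finset ℕ) (Q : κ → Finset ℕ) (V X : Finset ℕ) {p : ℕ}
    (hp : p = Fintype.card ι + Fintype.card κ) (hV : 3 * p ≤ V.card)
    (hPc : ∀ i, (P i).card = 2) (hQc : ∀ j, (Q j).card = 2)
    (hP : Pairwise fun i j => Disjoint (P i) (P j))
    (hQ : Pairwise fun i j => Disjoint (Q i) (Q j))
    (hPQ : ∀ i j, Disjoint (P i) (Q j))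
    (hPE : ∀ i, ∀ c ∈ V, c ∉ P i → insert c (P i) ∈ E)
    (hQE : ∀ j, ∀ c ∈ X, c ∉ Q j → insert c (Q j) ∈ E)
    (hcard : Fintype.card κ ≤ (X \ (Finset.univ.biUnion P ∪ Finset.univ.biUnion Q)).card) :
    HasMatching E p := by
  obtain ⟨c, hc, hcX⟩ := exists_injective_mem κ _ hcard
  set U := Finset.univ.biUnion P ∪ Finset.univ.biUnion Q with hU
  have hUc : U.card ≤ 2 * p := by
    refine (Finset.card_union_le _ _).trans ?_
    rw [card_biUnion_matching P 2 hPc hP, card_biUnion_matching Q 2 hQc hQ]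
    omega
  have h1 : Fintype.card ι ≤ (V \ (U ∪ Finset.univ.image c)).card := by
    have h2 := Finset.le_card_sdiff (U ∪ Finset.univ.image c) V
    have h3 := Finset.card_union_le U (Finset.univ.image c)
    have h4 : (Finset.univ.image c).card ≤ Fintype.card κ := Finset.card_image_le
    omega
  obtain ⟨d, hd, hdV⟩ := exists_injective_mem ι _ h1
  simp only [hU, Finset.mem_sdiff, Finset.mem_union, Finset.mem_biUnion, Finset.mem_image,
    Finset.mem_univ, true_and, not_or, not_exists] at hcX hdV
  refine HasMatching.of_fintype (ι := ι ⊕ κ)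
    (Sum.elim (fun i => insert (d i) (P i)) (fun j => insert (c j) (Q j))) ?_ ?_
    (by simp [hp])
  · rintro (i | j)
    · exact hPE i _ (hdV i).1 ((hdV i).2.1.1 i)
    · exact hQE j _ (hcX j).1 ((hcX j).2.2 j)
  · have key : ∀ (x y : ℕ) (A B : Finset ℕ), x ≠ y → x ∉ B → y ∉ A → Disjoint A B →
        Disjoint (insert x A) (insert y B) := by
      intro x y A B hxy hxB hyA hAB
      rw [Finset.disjoint_insert_left, Finset.disjoint_insert_right]
      exact ⟨by simp [hxy, hxB], hyA, hAB⟩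
    rintro (i | i) (j | j) hij
    · have hij' : i ≠ j := fun h => hij (by rw [h])
      exact key _ _ _ _ (hd.ne hij') ((hdV i).2.1.1 j) ((hdV j).2.1.1 i) (hP hij')
    · exact key _ _ _ _ (fun h => (hdV i).2.2 j h.symm) ((hdV i).2.1.2 j) ((hcX j).2.1 i) (hPQ i j)
    · exact key _ _ _ _ ((hdV j).2.2 i) ((hcX i).2.1 j) ((hdV j).2.1.2 i) (hPQ j i).symm
    · have hij' : i ≠ j := fun h => hij (by rw [h])
      exact key _ _ _ _ (hc.ne hij') ((hcX i).2.2 j) ((hcX j).2.2 i) (hQ hij')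

/-- The link graph of `x` inside `W`. -/
def link (E : Finset (Finset ℕ)) (x : ℕ) (W : Finset ℕ) : Finset (Finset ℕ) :=
  (W.powersetCard 2).filter fun A => insert x A ∈ E

/-- The triples inside `W` that do not belong to `E`. -/
def miss (E : Finset (Finset ℕ)) (W : Finset ℕ) : Finset (Finset ℕ) :=
  (W.powersetCard 3).filter fun A => A ∉ E

theorem mem_link {E : Finset (Finset ℕ)} {x : ℕ} {W A : Finset ℕ} :
    A ∈ link E x W ↔ A ∈ W.powersetCard 2 ∧ insert x A ∈ E := Finset.mem_filter

theorem mem_miss {E : Finset (Finset ℕ)} {W A : Finset ℕ} :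
    A ∈ miss E W ↔ (A ⊆ W ∧ A.card = 3) ∧ A ∉ E := by
  rw [miss, Finset.mem_filter, Finset.mem_powersetCard]

theorem Shifted.pairStable_link {E : Finset (Finset ℕ)} (hE : Shifted E) {t : ℕ} {W : Finset ℕ}
    (ht : t ∉ W) (hW : ∀ x ∈ W, 1 ≤ x) : PairStable (link E t W) W := by
  intro x hx y hy z hz hxy hzy hzx h
  rw [mem_link, pair_mem_powersetCard] at h ⊢
  have e1 : ({t, x, y} : Finset ℕ) = insert x {t, y} := by grind
  have e2 : ({t, z, y} : Finset ℕ) = insert z {t, y} := by grind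
  have hxt : x ≠ t := fun h => ht (h ▸ hx)
  have hzt : z ≠ t := fun h => ht (h ▸ hz)
  refine ⟨⟨hzy, hz, hy⟩, ?_⟩
  rw [e2]
  exact hE _ x z (by simp [hxt, hxy]) (by simp [hzt, hzy]) (hW z hz) hzx.le (e1 ▸ h.2)

/-- If `{v, b}` can be completed by the last vertex, then the link of `x ≤ b` on vertices above
`v` has small matching number as soon as enough room is left in `(v, b]` and `(v, x]`. -/
theorem Shifted.not_hasMatching_link {E : Finset (Finset ℕ)} (hE : Shifted E) {s v b x p : ℕ}
    {W : Finset ℕ} (hM : ¬ HasMatching E (s + 1)) (hp : v + p = s + 1) (hvb : v < b)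
    (hb : b ≤ 3 * s + 2) (hG : ({3 * s + 3, v, b} : Finset ℕ) ∈ E)
    (hW : W ⊆ Finset.Ioc v (3 * s + 3)) (hxW : x ∉ W)
    (hU : ∀ U ⊆ W, U.card = p * 2 → (U ∩ Finset.Ioc v b).card + (s + 1 + v) ≤ b ∧
      (U ∩ Finset.Ioc v x).card + p + v ≤ x) :
    ¬ HasMatching (link E x W) p := by
  rintro ⟨Q, hQ, hQd⟩
  simp only [mem_link, Finset.mem_powersetCard] at hQ
  set U := Finset.univ.biUnion Q with hUdef
  have hUW : U ⊆ W := Finset.biUnion_subset.2 fun i _ => (hQ i).1.1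
  obtain ⟨h1, h2⟩ := hU U hUW (by
    rw [hUdef, card_biUnion_matching Q 2 (fun i => (hQ i).1.2) hQd, Fintype.card_fin])
  have h3 : p ≤ (Finset.Ioc v x \ U).card := by
    have h4 := Finset.card_sdiff_add_card_inter (Finset.Ioc v x) U
    rw [Finset.inter_comm, Nat.card_Ioc] at h4
    omega
  obtain ⟨C, hC, hCc⟩ := Finset.exists_subset_card_eq h3
  have h5 : v ≤ ((Finset.Ioc v b \ U) \ C).card := by
    have h4 := Finset.card_sdiff_add_card_inter (Finset.Ioc v b) U
    rw [Finset.inter_comm, Nat.card_Ioc] at h4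
    have h6 := Finset.le_card_sdiff C (Finset.Ioc v b \ U)
    omega
  obtain ⟨d, hd, hdm⟩ := exists_injective_mem (Fin v) _ (by simpa using h5)
  simp only [Finset.mem_sdiff, Finset.mem_Ioc] at hdm
  have hUv : ∀ i, ∀ a ∈ Q i, v < a ∧ a ≤ 3 * s + 3 := fun i a ha =>
    Finset.mem_Ioc.1 (hW ((hQ i).1.1 ha))
  have hUm : ∀ i, ∀ a ∈ Q i, a ∈ U := fun i a ha => Finset.mem_biUnion.2 ⟨i, Finset.mem_univ _, ha⟩
  refine hM (hasMatching_of_pairs (fun i : Fin v => {i.1 + 1, d i}) Q (Finset.Icc 1 (3 * s + 3))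
    (Finset.Icc 1 x) (by simp [hp]) (by simp; omega)
    ?_ (fun i => (hQ i).1.2) ?_ hQd ?_ ?_ ?_ ?_)
  · intro i
    have := (hdm i).1.1.1
    exact Finset.card_pair (by have := i.2; omega)
  · intro i j hij
    have h6 := hd.ne hij
    have h7 := (hdm i).1.1.1
    have h8 := (hdm j).1.1.1
    have h9 := Fin.val_ne_of_ne hij
    have h10 := i.2
    have h11 := j.2
    simp only [Finset.disjoint_insert_left, Finset.disjoint_singleton_left, Finset.mem_insert,
      Finset.mem_singleton, not_or]
    refine ⟨⟨?_, ?_⟩, ?_, h6⟩ <;> omega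
  · intro i j
    simp only [Finset.disjoint_insert_left, Finset.disjoint_singleton_left]
    refine ⟨fun h => ?_, fun h => (hdm i).1.2 (hUm j _ h)⟩
    have := (hUv j _ h).1
    have := i.2
    omega
  · intro i c hc hci
    rw [Finset.mem_Icc] at hc
    have h6 := hdm i
    have h7 := i.2
    refine hE _ (3 * s + 3) c ?_ hci hc.1 hc.2 ?_
    · simp only [Finset.mem_insert, Finset.mem_singleton, not_or]
      omega
    · exact hE.triple (by omega) hvb (by omega) (by omega) (by omega) (by omega) h6.1.1.2 le_rfl hG
  · intro j c hc hcj
    rw [Finset.mem_Icc] at hc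
    exact hE _ x c (fun h => hxW ((hQ j).1.1 h)) hcj hc.1 hc.2 (hQ j).2
  · rw [Fintype.card_fin]
    refine hCc.ge.trans (Finset.card_le_card fun a ha => ?_)
    have h6 := hC ha
    simp only [Finset.mem_sdiff, Finset.mem_Ioc] at h6
    simp only [Finset.mem_sdiff, Finset.mem_Icc, Finset.mem_union, Finset.mem_biUnion,
      Finset.mem_univ, true_and, not_or, not_exists, Finset.mem_insert, Finset.mem_singleton]
    refine ⟨by omega, fun i => ⟨by have := i.2; omega, fun h => (hdm i).2 (h ▸ ha)⟩,
      fun i h => h6.2 (hUm i a h)⟩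

/-- The link graph of the vertex `3 s + 3` on the smaller vertices. -/
def topGraph (E : Finset (Finset ℕ)) (s : ℕ) : Finset (Finset ℕ) :=
  link E (3 * s + 3) (Finset.Icc 1 (3 * s + 2))

/-- The bound `(s + 1) g ≤ 2 m` for shifted families without `s + 1` disjoint members, where `g`
is the degree of the last vertex `3 s + 3` and `m` the number of missing triples below it. -/
def LinkBound (s : ℕ) : Prop :=
  ∀ E : Finset (Finset ℕ), Shifted E → ¬ HasMatching E (s + 1) →
    (s + 1) * (topGraph E s).card ≤
      2 * (miss E (Finset.Icc 1 (3 * s + 2))).card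

theorem card_filter_powersetCard_map (φ : ℕ ↪ ℕ) (k : ℕ) (W : Finset ℕ) (p : Finset ℕ → Prop)
    [DecidablePred p] : (((W.map φ).powersetCard k).filter p).card =
      ((W.powersetCard k).filter fun A => p (A.map φ)).card := by
  rw [Finset.powersetCard_map, Finset.filter_map, Finset.card_map]
  rfl

/-- Pulling back a family along a strictly monotone relabelling of the first `n` vertices. -/
def pullback (φ : ℕ ↪ ℕ) (n : ℕ) (E : Finset (Finset ℕ)) : Finset (Finset ℕ) :=
  ((Finset.Icc 1 n).powersetCard 3).filter fun A => A.map φ ∈ E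

theorem mem_pullback {φ : ℕ ↪ ℕ} {n : ℕ} {E : Finset (Finset ℕ)} {A : Finset ℕ} :
    A ∈ pullback φ n E ↔ (A ⊆ Finset.Icc 1 n ∧ A.card = 3) ∧ A.map φ ∈ E := by
  rw [pullback, Finset.mem_filter, Finset.mem_powersetCard]

theorem Shifted.pullback {E : Finset (Finset ℕ)} (hE : Shifted E) {φ : ℕ ↪ ℕ} (hφ : StrictMono φ)
    (hφ1 : 1 ≤ φ 1) (n : ℕ) : Shifted (pullback φ n E) := by
  intro A x y hx hy hy1 hyx h
  rw [mem_pullback] at h ⊢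
  rw [Finset.map_insert] at h ⊢
  rw [Finset.card_insert_of_notMem hx] at h
  rw [Finset.card_insert_of_notMem hy]
  rw [Finset.insert_subset_iff, Finset.mem_Icc] at h ⊢
  exact ⟨⟨⟨⟨hy1, by omega⟩, h.1.1.2⟩, h.1.2⟩,
    hE _ _ _ (by simpa using hx) (by simpa using hy) (hφ1.trans (hφ.monotone hy1))
      (hφ.monotone hyx) h.2⟩

theorem HasMatching.of_pullback {E E' : Finset (Finset ℕ)} {φ : ℕ ↪ ℕ} {n p : ℕ}
    (h : HasMatching (_root_.pullback φ n E) p)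
    (hE : ∀ A ∈ E, A ⊆ (Finset.Icc 1 n).map φ → A ∈ E') : HasMatching E' p := by
  obtain ⟨f, hf, hd⟩ := h
  simp only [mem_pullback] at hf
  exact ⟨fun i => (f i).map φ, fun i => hE _ (hf i).2 (Finset.map_subset_map.2 (hf i).1.1),
    fun i j hij => (Finset.disjoint_map φ).2 (hd hij)⟩

theorem LinkBound.relabel {s : ℕ} (hs : LinkBound s) {E : Finset (Finset ℕ)} (hE : Shifted E)
    {φ : ℕ ↪ ℕ} (hφ : StrictMono φ) (hφ1 : 1 ≤ φ 1)
    (hM : ¬ HasMatching (E.filter fun A => A ⊆ (Finset.Icc 1 (3 * s + 3)).map φ) (s + 1)) :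
    (s + 1) * (link E (φ (3 * s + 3)) ((Finset.Icc 1 (3 * s + 2)).map φ)).card ≤
      2 * (miss E ((Finset.Icc 1 (3 * s + 2)).map φ)).card := by
  have h := hs (pullback φ (3 * s + 3) E) (hE.pullback hφ hφ1 _) fun h => hM (h.of_pullback
    fun A hA hA' => Finset.mem_filter.2 ⟨hA, hA'⟩)
  convert h using 2
  · rw [topGraph, link, link, card_filter_powersetCard_map]
    congr 1
    refine Finset.filter_congr fun A hA => ?_
    rw [Finset.mem_powersetCard] at hA
    rw [← Finset.map_insert, mem_pullback, Finset.card_insert_of_notMem, Finset.insert_subset_iff]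
    · simp only [Finset.mem_Icc, hA.2, and_true]
      have := hA.1.trans (Finset.Icc_subset_Icc le_rfl (by omega : 3 * s + 2 ≤ 3 * s + 3))
      simp [this]
    · intro h
      have := hA.1 h
      simp at this
  · rw [miss, card_filter_powersetCard_map]
    congr 1
    refine Finset.filter_congr fun A hA => ?_
    rw [Finset.mem_powersetCard] at hA
    have := hA.1.trans (Finset.Icc_subset_Icc le_rfl (by omega : 3 * s + 2 ≤ 3 * s + 3))
    simp [mem_pullback, hA.2, this]

theorem linkBound_one : LinkBound 1 := by
  intro E hE hM
  have key : ∀ A ∈ link E 6 (Finset.Icc 1 5), A ⊆ Finset.Icc 1 5 ∧ A.card = 2 ∧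
      Finset.Icc 1 5 \ A ∈ miss E (Finset.Icc 1 5) := by
    intro A hA
    rw [mem_link, Finset.mem_powersetCard] at hA
    refine ⟨hA.1.1, hA.1.2, ?_⟩
    rw [mem_miss, Finset.card_sdiff_of_subset hA.1.1, hA.1.2]
    refine ⟨⟨Finset.sdiff_subset, by simp⟩, fun h => hM ?_⟩
    refine HasMatching.of_option (fun _ : Fin 1 => insert 6 A) (fun _ => hA.2)
      (fun i j hij => absurd (Subsingleton.elim i j) hij) h (fun _ => ?_) (by simp)
    rw [Finset.disjoint_insert_right]
    exact ⟨by simp, Finset.sdiff_disjoint⟩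
  have h := Finset.card_le_card_of_injOn (fun A => Finset.Icc 1 5 \ A)
    (fun A hA => (key A hA).2.2) (fun A hA B hB hAB => by
      have h1 := Finset.sdiff_sdiff_eq_self (key A hA).1
      have h2 := Finset.sdiff_sdiff_eq_self (key B hB).1
      rw [← h1, ← h2]
      exact congrArg (Finset.Icc 1 5 \ ·) hAB)
  simpa [topGraph] using h

/-- The increasing enumeration of the natural numbers other than `a < b`. -/
def skip (a b i : ℕ) : ℕ := if i < a then i else if i + 1 < b then i + 1 else i + 2

theorem skip_strictMono (a b : ℕ) : StrictMono (skip a b) := by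
  intro i j hij
  unfold skip
  split_ifs <;> omega

theorem map_skip {a b n : ℕ} (ha : 1 ≤ a) (hab : a < b) (hb : b ≤ n + 2) :
    (Finset.Icc 1 n).map ⟨skip a b, (skip_strictMono a b).injective⟩ =
      Finset.Icc 1 (n + 2) \ {a, b} := by
  ext x
  simp only [Finset.mem_map, Finset.mem_Icc, Function.Embedding.coeFn_mk, Finset.mem_sdiff,
    Finset.mem_insert, Finset.mem_singleton]
  constructor
  · rintro ⟨i, hi, rfl⟩
    unfold skip
    split_ifs <;> omega
  · rintro ⟨hx, hx'⟩
    by_cases h1 : x < a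
    · exact ⟨x, by omega, by simp [skip, h1]⟩
    · by_cases h2 : x < b
      · refine ⟨x - 1, by omega, ?_⟩
        unfold skip
        split_ifs <;> omega
      · refine ⟨x - 2, by omega, ?_⟩
        unfold skip
        split_ifs <;> omega

theorem mem_topGraph {E : Finset (Finset ℕ)} {s x y : ℕ} :
    {x, y} ∈ topGraph E s ↔ (x ≠ y ∧ (1 ≤ x ∧ x ≤ 3 * s + 2) ∧ (1 ≤ y ∧ y ≤ 3 * s + 2)) ∧
      {3 * s + 3, x, y} ∈ E := by
  rw [topGraph, mem_link, pair_mem_powersetCard, Finset.mem_Icc, Finset.mem_Icc]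

theorem exists_of_mem_topGraph {E : Finset (Finset ℕ)} {s : ℕ} {A : Finset ℕ}
    (hA : A ∈ topGraph E s) : ∃ x y, 1 ≤ x ∧ x < y ∧ y ≤ 3 * s + 2 ∧ A = {x, y} ∧
      ({3 * s + 3, x, y} : Finset ℕ) ∈ E := by
  have h := (mem_link.1 hA)
  obtain ⟨x, y, hxy, hx, hy, rfl⟩ := mem_powersetCard_two h.1
  rw [Finset.mem_Icc] at hx hy
  exact ⟨x, y, hx.1, hxy, hy.2, rfl, h.2⟩

/-- Inductive step for `LinkBound`: remove an edge `{a, b}` of the top graph. -/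
theorem LinkBound.remove_edge {q : ℕ} (ih : LinkBound q) (hq : 1 ≤ q) {E : Finset (Finset ℕ)}
    (hE : Shifted E) {s : ℕ} (hs : s = q + 1) (hM : ¬ HasMatching E (s + 1))
    (h0 : ({3 * s + 3, 1, 3 * s + 2} : Finset ℕ) ∉ E) {a b : ℕ} (ha : 1 ≤ a) (hab : a < b)
    (hG : ({3 * s + 3, a, b} : Finset ℕ) ∈ E) (hb : b ≤ 3 * s + 1)
    {S : Finset (Finset ℕ)} (hS : S ⊆ miss E (Finset.Icc 1 (3 * s + 2)))
    (hSab : ∀ T ∈ S, a ∈ T ∨ b ∈ T) {N₁ N₂ : Finset ℕ} {D : ℕ}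
    (hN₁ : ∀ w, {a, w} ∈ topGraph E s → w ∈ N₁)
    (hN₂ : ∀ w, w ≠ a → {b, w} ∈ topGraph E s → w ∈ N₂) (hD : N₁.card + N₂.card ≤ D)
    (hK : 3 * (topGraph E s).card + s * D + 9 * s ≤ 2 * S.card + 9 * s * s + 2 + 2 * D) :
    (s + 1) * (topGraph E s).card ≤ 2 * (miss E (Finset.Icc 1 (3 * s + 2))).card := by
  set V := Finset.Icc 1 (3 * s + 1) \ {a, b} with hV
  have htop : ∀ A ∈ topGraph E s, A ⊆ Finset.Icc 1 (3 * s + 1) := by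
    intro A hA
    obtain ⟨x, y, hx, hxy, hy, rfl, h⟩ := exists_of_mem_topGraph hA
    have : y ≠ 3 * s + 2 := by
      rintro rfl
      exact h0 (hE.triple le_rfl hxy (by omega) (by omega) (by omega) hx le_rfl le_rfl h)
    intro z hz
    simp only [Finset.mem_insert, Finset.mem_singleton] at hz
    rw [Finset.mem_Icc]
    omega
  have hVc : V.card = 3 * s - 1 := by
    rw [hV, Finset.card_sdiff_of_subset, Finset.card_pair hab.ne, Nat.card_Icc]
    · omega
    · intro z hz
      simp only [Finset.mem_insert, Finset.mem_singleton] at hz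
      rw [Finset.mem_Icc]
      omega
  have hm1 : (Finset.Icc 1 (3 * q + 2)).map ⟨skip a b, (skip_strictMono a b).injective⟩ = V := by
    rw [map_skip ha hab (by omega), hV, show 3 * q + 2 + 2 = 3 * s + 1 by omega]
  have hm2 : (Finset.Icc 1 (3 * q + 3)).map ⟨skip a b, (skip_strictMono a b).injective⟩ =
      Finset.Icc 1 (3 * s + 2) \ {a, b} := by
    rw [map_skip ha hab (by omega), show 3 * q + 3 + 2 = 3 * s + 2 by omega]
  have hrel := ih.relabel hE (φ := ⟨skip a b, (skip_strictMono a b).injective⟩)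
    (skip_strictMono a b) (by simp only [Function.Embedding.coeFn_mk]; unfold skip; split_ifs <;> omega) (by
      rw [hm2]
      rintro ⟨f, hf, hd⟩
      simp only [Finset.mem_filter] at hf
      refine hM (HasMatching.of_option f (fun i => (hf i).1) hd hG (fun i => ?_) (by simp [hs]))
      rw [Finset.disjoint_left]
      intro x hx hxi
      have h1 := (hf i).2 hxi
      simp only [Finset.mem_insert, Finset.mem_singleton, Finset.mem_sdiff, Finset.mem_Icc] at h1 hx
      omega)
  rw [hm1] at hrel
  have hsk : skip a b (3 * q + 3) = 3 * s + 2 := by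
    unfold skip
    split_ifs <;> omega
  simp only [Function.Embedding.coeFn_mk, hsk] at hrel
  set L := link E (3 * s + 2) V with hL
  have hVV : V ⊆ Finset.Icc 1 (3 * s + 2) :=
    Finset.sdiff_subset.trans (Finset.Icc_subset_Icc le_rfl (by omega))
  have hnV : 3 * s + 2 ∉ V := by simp [hV]
  have hg : (topGraph E s).card ≤ L.card + D := by
    have : topGraph E s ⊆ L ∪ (N₁.image (fun w => ({a, w} : Finset ℕ)) ∪
        N₂.image (fun w => ({b, w} : Finset ℕ))) := by
      intro A hA
      simp only [Finset.mem_union, Finset.mem_image]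
      have h2 := htop A hA
      have h3 := mem_link.1 hA
      by_cases haA : a ∈ A
      · right; left
        obtain ⟨x, y, hx, hxy, hy, rfl, h⟩ := exists_of_mem_topGraph hA
        simp only [Finset.mem_insert, Finset.mem_singleton] at haA
        rcases haA with rfl | rfl
        · exact ⟨y, hN₁ y hA, rfl⟩
        · exact ⟨x, hN₁ x (by rwa [Finset.pair_comm]), Finset.pair_comm _ _⟩
      by_cases hbA : b ∈ A
      · right; right
        obtain ⟨x, y, hx, hxy, hy, rfl, h⟩ := exists_of_mem_topGraph hA
        simp only [Finset.mem_insert, Finset.mem_singleton] at hbA haA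
        rcases hbA with rfl | rfl
        · exact ⟨y, hN₂ y (by omega) hA, rfl⟩
        · exact ⟨x, hN₂ x (by omega) (by rwa [Finset.pair_comm]), Finset.pair_comm _ _⟩
      left
      rw [hL, mem_link, Finset.mem_powersetCard]
      refine ⟨⟨fun z hz => ?_, (Finset.mem_powersetCard.1 h3.1).2⟩, ?_⟩
      · rw [hV, Finset.mem_sdiff]
        refine ⟨h2 hz, ?_⟩
        simp only [Finset.mem_insert, Finset.mem_singleton]
        rintro (rfl | rfl) <;> contradiction
      · refine hE A (3 * s + 3) (3 * s + 2) (fun h => ?_) (fun h => ?_) (by omega) (by omega) h3.2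
        · have := h2 h
          simp at this
        · have := h2 h
          simp at this
    have h4 := Finset.card_le_card this
    have h5 := Finset.card_union_le L (N₁.image (fun w => ({a, w} : Finset ℕ)) ∪
        N₂.image (fun w => ({b, w} : Finset ℕ)))
    have h6 := Finset.card_union_le (N₁.image (fun w => ({a, w} : Finset ℕ)))
        (N₂.image (fun w => ({b, w} : Finset ℕ)))
    have h7 : (N₁.image (fun w => ({a, w} : Finset ℕ))).card ≤ N₁.card := Finset.card_image_le
    have h8 : (N₂.image (fun w => ({b, w} : Finset ℕ))).card ≤ N₂.card := Finset.card_image_le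
    omega
  set L' := (V.powersetCard 2).filter (fun A => ¬ insert (3 * s + 2) A ∈ E) with hL'
  have hLL' : L.card + L'.card = (3 * s - 1).choose 2 := by
    rw [← hVc, ← Finset.card_powersetCard]
    exact Finset.card_filter_add_card_filter_not _
  have hm : S.card + (miss E V).card + L'.card ≤ (miss E (Finset.Icc 1 (3 * s + 2))).card := by
    have hinj : (L'.image (insert (3 * s + 2))).card = L'.card := by
      refine Finset.card_image_of_injOn fun A hA B hB hAB => ?_
      have h1 : ∀ A ∈ L', 3 * s + 2 ∉ A := fun A hA h =>
        hnV ((Finset.mem_powersetCard.1 (Finset.mem_filter.1 hA).1).1 h)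
      rw [← Finset.erase_insert (h1 A hA), ← Finset.erase_insert (h1 B hB)]
      exact congrArg (Finset.erase · (3 * s + 2)) hAB
    rw [← hinj, ← Finset.card_union_of_disjoint, ← Finset.card_union_of_disjoint]
    · refine Finset.card_le_card (Finset.union_subset (Finset.union_subset hS ?_) ?_)
      · intro T hT
        rw [mem_miss] at hT ⊢
        exact ⟨⟨hT.1.1.trans hVV, hT.1.2⟩, hT.2⟩
      · intro T hT
        rw [Finset.mem_image] at hT
        obtain ⟨A, hA, rfl⟩ := hT
        rw [hL', Finset.mem_filter, Finset.mem_powersetCard] at hA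
        rw [mem_miss, Finset.card_insert_of_notMem fun h => hnV (hA.1.1 h)]
        exact ⟨⟨Finset.insert_subset (by simp) (hA.1.1.trans hVV), by omega⟩, hA.2⟩
    · rw [Finset.disjoint_union_left]
      constructor
      · rw [Finset.disjoint_left]
        intro T hT hT'
        rw [Finset.mem_image] at hT'
        obtain ⟨A, hA, rfl⟩ := hT'
        rw [hL', Finset.mem_filter, Finset.mem_powersetCard] at hA
        have h1 : ∀ z, z ∈ insert (3 * s + 2) A → z ≠ a ∧ z ≠ b := by
          intro z hz
          rw [Finset.mem_insert] at hz
          rcases hz with rfl | hz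
          · omega
          · have := hA.1.1 hz
            simp only [hV, Finset.mem_sdiff, Finset.mem_insert, Finset.mem_singleton] at this
            omega
        rcases hSab _ hT with h | h
        · exact (h1 _ h).1 rfl
        · exact (h1 _ h).2 rfl
      · rw [Finset.disjoint_left]
        intro T hT hT'
        rw [Finset.mem_image] at hT'
        obtain ⟨A, hA, rfl⟩ := hT'
        exact hnV ((mem_miss.1 hT).1.1 (by simp))
    · rw [Finset.disjoint_left]
      intro T hT hT'
      have h1 := (mem_miss.1 hT').1.1
      rcases hSab T hT with h | h
      · have := h1 h
        simp [hV] at this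
      · have := h1 h
        simp [hV] at this
  have hch : 2 * (3 * s - 1).choose 2 + 9 * s = 9 * s * s + 2 := by
    obtain ⟨c, rfl⟩ : ∃ c, s = c + 1 := ⟨s - 1, by omega⟩
    have h1 : 3 * (c + 1) - 1 = 3 * c + 2 := by omega
    rw [h1, Nat.choose_two_right, Nat.mul_div_cancel' (Nat.even_mul_pred_self _).two_dvd]
    have h2 : 3 * c + 2 - 1 = 3 * c + 1 := by omega
    rw [h2]
    ring
  obtain ⟨c, rfl⟩ : ∃ c, q = c + 1 := ⟨q - 1, by omega⟩
  subst hs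
  nlinarith

/-- The members of `Q` containing an element at most `k`. -/
def low (Q : Finset (Finset ℕ)) (k : ℕ) : Finset (Finset ℕ) :=
  Q.filter fun A => ∃ x ∈ A, x ≤ k

theorem card_low_le {Q : Finset (Finset ℕ)} {W : Finset ℕ} (hQW : Q ⊆ W.powersetCard 2)
    (F : ℕ → ℤ) (u : ℕ → ℕ) {m k : ℕ} (hmk : m ≤ k)
    (hu : ∀ x, m ≤ x → x < k → x + 1 ≤ u (x + 1) ∧
      2 * ((u (x + 1) : ℤ) - (x + 1)) ≤ F (x + 1) - F x)
    (hQ : ∀ x y, m < x → x ≤ k → x < y → {x, y} ∈ Q → y ≤ u x) :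
    2 * ((low Q k).card : ℤ) ≤ 2 * (low Q m).card + F k - F m := by
  induction k, hmk using Nat.le_induction with
  | base => simp
  | succ k hmk ih =>
    have h1 := ih (fun x h1 h2 => hu x h1 (by omega)) (fun x y h1 h2 => hQ x y h1 (by omega))
    obtain ⟨h2, h3⟩ := hu k hmk (by omega)
    have h4 : (low Q (k + 1)).card ≤ (low Q k).card + (u (k + 1) - (k + 1)) := by
      rw [← Nat.card_Ioc]
      refine (Finset.card_le_card (t := low Q k ∪ (Finset.Ioc (k + 1) (u (k + 1))).image
        fun y => ({k + 1, y} : Finset ℕ)) ?_).trans ((Finset.card_union_le _ _).trans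
          (Nat.add_le_add_left Finset.card_image_le _))
      intro A hA
      rw [low, Finset.mem_filter] at hA
      rw [Finset.mem_union, low, Finset.mem_filter, Finset.mem_image]
      obtain ⟨x, y, hxy, -, -, rfl⟩ := mem_powersetCard_two (hQW hA.1)
      simp only [Finset.mem_insert, Finset.mem_singleton, exists_eq_or_imp, exists_eq_left,
        Finset.mem_Ioc] at hA ⊢
      by_cases hx : x ≤ k
      · exact Or.inl ⟨hA.1, Or.inl hx⟩
      · have : x = k + 1 := by omega
        subst this
        exact Or.inr ⟨y, ⟨hxy, hQ _ _ (by omega) le_rfl hxy hA.1⟩, rfl⟩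
    have h5 : ((low Q (k + 1)).card : ℤ) ≤ (low Q k).card + (u (k + 1) - (k + 1)) := by
      have : ((u (k + 1) - (k + 1) : ℕ) : ℤ) = (u (k + 1) : ℤ) - (k + 1) := by
        rw [Nat.cast_sub h2]; push_cast; ring
      rw [← this]
      exact_mod_cast h4
    linarith

theorem low_zero {E : Finset (Finset ℕ)} {s : ℕ} : low (topGraph E s) 0 = ∅ := by
  rw [low, Finset.filter_eq_empty_iff]
  intro A hA
  obtain ⟨x, y, hx, hxy, hy, rfl, h⟩ := exists_of_mem_topGraph hA
  simp only [Finset.mem_insert, Finset.mem_singleton, exists_eq_or_imp, exists_eq_left]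
  omega

theorem low_eq_self {E : Finset (Finset ℕ)} {s k : ℕ}
    (h : ∀ x y, 1 ≤ x → x < y → y ≤ 3 * s + 2 → {3 * s + 3, x, y} ∈ E → x ≤ k) :
    low (topGraph E s) k = topGraph E s := by
  rw [low, Finset.filter_eq_self]
  intro A hA
  obtain ⟨x, y, hx, hxy, hy, rfl, h'⟩ := exists_of_mem_topGraph hA
  exact ⟨x, by simp, h x y hx hxy hy h'⟩

/-- A link graph with small matching number gives many missing triples. -/
theorem Shifted.exists_missing {E : Finset (Finset ℕ)} (hE : Shifted E) {n x r M : ℕ}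
    {W : Finset ℕ} (hW : W ⊆ Finset.Icc 1 n) (hx : x ∈ Finset.Icc 1 n) (hxW : x ∉ W)
    (hM : ¬ HasMatching (link E x W) (r + 1)) (hc : W.card = M + r) :
    ∃ S ⊆ miss E (Finset.Icc 1 n), (∀ T ∈ S, x ∈ T ∧ T ⊆ insert x W) ∧
      ∃ j ≤ r, (M + j) * (M + j) ≤ 2 * S.card + (2 * j + 1) * (2 * j) + (M + j) := by
  set L' := (W.powersetCard 2).filter (fun A => ¬ insert x A ∈ E) with hL'
  have hLL' : (link E x W).card + L'.card = W.card.choose 2 := by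
    rw [← Finset.card_powersetCard]
    exact Finset.card_filter_add_card_filter_not _
  have hsub : ∀ A ∈ L', (A ⊆ W ∧ A.card = 2) ∧ insert x A ∉ E ∧ x ∉ A := by
    intro A hA
    rw [hL', Finset.mem_filter, Finset.mem_powersetCard] at hA
    exact ⟨hA.1, hA.2, fun h => hxW (hA.1.1 h)⟩
  have hinj : (L'.image (insert x)).card = L'.card := by
    refine Finset.card_image_of_injOn fun A hA B hB hAB => ?_
    rw [← Finset.erase_insert (hsub A hA).2.2, ← Finset.erase_insert (hsub B hB).2.2]
    exact congrArg (Finset.erase · x) hAB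
  refine ⟨L'.image (insert x), ?_, ?_, ?_⟩
  · intro T hT
    obtain ⟨A, hA, rfl⟩ := Finset.mem_image.1 hT
    obtain ⟨h1, h2, h3⟩ := hsub A hA
    rw [mem_miss, Finset.card_insert_of_notMem h3]
    exact ⟨⟨Finset.insert_subset hx (h1.1.trans hW), by omega⟩, h2⟩
  · intro T hT
    obtain ⟨A, hA, rfl⟩ := Finset.mem_image.1 hT
    exact ⟨by simp, Finset.insert_subset_insert _ (hsub A hA).1.1⟩
  · obtain ⟨i, j, hij, h⟩ := card_le_of_pairStable r W (link E x W) (Finset.filter_subset _ _)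
      (hE.pairStable_link hxW fun y hy => (Finset.mem_Icc.1 (hW hy)).1) hM
    refine ⟨j, by omega, ?_⟩
    rw [hinj]
    have h2 : 2 * W.card.choose 2 + W.card = W.card * W.card := by
      rw [Nat.choose_two_right, Nat.mul_div_cancel' (Nat.even_mul_pred_self _).two_dvd]
      rcases W.card with _ | c
      · rfl
      · simp only [Nat.add_sub_cancel]; ring
    rw [hc] at *
    subst hij
    nlinarith

theorem not_hasMatching_topGraph {E : Finset (Finset ℕ)} (hE : Shifted E) {s : ℕ}
    (hM : ¬ HasMatching E (s + 1)) : ¬ HasMatching (topGraph E s) (s + 1) := by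
  rintro ⟨f, hf, hd⟩
  simp only [topGraph, mem_link, Finset.mem_powersetCard] at hf
  refine hM (hasMatching_of_pairs f (fun i : Fin 0 => i.elim0) (Finset.Icc 1 (3 * s + 3)) ∅
    (by simp) (by simp; omega) (fun i => (hf i).1.2) (fun i => i.elim0) hd (fun i => i.elim0)
    (fun _ i => i.elim0) (fun i c hc hci => ?_) (fun i => i.elim0) (by simp))
  rw [Finset.mem_Icc] at hc
  refine hE _ _ c (fun h => ?_) hci hc.1 hc.2 (hf i).2
  have := (hf i).1.1 h
  simp at this

theorem topGraph_subset {E : Finset (Finset ℕ)} (hE : Shifted E) {s : ℕ}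
    (h0 : ({3 * s + 3, 1, 3 * s + 2} : Finset ℕ) ∉ E) :
    topGraph E s ⊆ (Finset.Icc 1 (3 * s + 1)).powersetCard 2 := by
  intro A hA
  obtain ⟨x, y, hx, hxy, hy, rfl, h⟩ := exists_of_mem_topGraph hA
  have : y ≠ 3 * s + 2 := by
    rintro rfl
    exact h0 (hE.triple le_rfl hxy (by omega) (by omega) (by omega) hx le_rfl le_rfl h)
  rw [pair_mem_powersetCard, Finset.mem_Icc, Finset.mem_Icc]
  omega

theorem two_mul_card_topGraph_le {E : Finset (Finset ℕ)} (hE : Shifted E) {s : ℕ}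
    (hM : ¬ HasMatching E (s + 1)) (h0 : ({3 * s + 3, 1, 3 * s + 2} : Finset ℕ) ∉ E) :
    2 * (topGraph E s).card ≤ 5 * s * s + s := by
  obtain ⟨i, j, hij, h⟩ := card_le_of_pairStable s (Finset.Icc 1 (3 * s + 1)) (topGraph E s)
    (topGraph_subset hE h0) (by
      have h1 := hE.pairStable_link (t := 3 * s + 3) (W := Finset.Icc 1 (3 * s + 2)) (by simp)
        (fun x hx => (Finset.mem_Icc.1 hx).1)
      have h2 : Finset.Icc 1 (3 * s + 1) ⊆ Finset.Icc 1 (3 * s + 2) :=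
        Finset.Icc_subset_Icc le_rfl (by omega)
      exact fun x hx y hy z hz => h1 x (h2 hx) y (h2 hy) z (h2 hz))
    (not_hasMatching_topGraph hE hM)
  rw [Nat.card_Icc] at h
  simp only [Nat.add_sub_cancel] at h
  subst hij
  nlinarith [Nat.zero_le (i * j), Nat.zero_le (j * j), mul_self_nonneg (j : ℤ), Nat.le_mul_self j]

/-- The edge `{s + 1, 2 s + 2}` cannot lie in the top graph. -/
theorem not_mem_of_perfect {E : Finset (Finset ℕ)} (hE : Shifted E) {s : ℕ}
    (hM : ¬ HasMatching E (s + 1)) : ({3 * s + 3, s + 1, 2 * s + 2} : Finset ℕ) ∉ E := by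
  intro h
  refine not_hasMatching_topGraph hE hM (HasMatching.of_fintype
    (fun i : Fin (s + 1) => ({i.1 + 1, s + 2 + i.1} : Finset ℕ)) (fun i => ?_) ?_ (by simp))
  · have := i.2
    rw [mem_topGraph]
    refine ⟨by omega, hE.triple (by omega) (by omega) (by omega) (by omega) (by omega) (by omega)
      (by omega) le_rfl h⟩
  · intro i j hij
    have h9 := Fin.val_ne_of_ne hij
    have h10 := i.2
    have h11 := j.2
    simp only [Finset.disjoint_insert_left, Finset.disjoint_singleton_left, Finset.mem_insert,
      Finset.mem_singleton, not_or]
    refine ⟨⟨?_, ?_⟩, ?_, ?_⟩ <;> omega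

theorem Shifted.of_mem_topGraph {E : Finset (Finset ℕ)} (hE : Shifted E) {s x y x' y' : ℕ}
    (h : {x, y} ∈ topGraph E s) (h1 : 1 ≤ x') (h2 : x' < y') (h3 : x' ≤ x) (h4 : x' ≤ y)
    (h5 : y' ≤ x ∨ y' ≤ y) : ({3 * s + 3, x', y'} : Finset ℕ) ∈ E := by
  obtain ⟨⟨hxy, hx, hy⟩, h⟩ := mem_topGraph.1 h
  rcases lt_or_gt_of_ne hxy with hlt | hlt
  · exact hE.triple h1 hlt (by omega) h2 (by omega) h3 (by omega) le_rfl h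
  · rw [Finset.pair_comm] at h
    exact hE.triple h1 hlt (by omega) h2 (by omega) h4 (by omega) le_rfl h

theorem Shifted.exists_missing_above {E : Finset (Finset ℕ)} (hE : Shifted E) {s b x : ℕ}
    (hM : ¬ HasMatching E (s + 1)) (hb : s + 2 ≤ b) (hb' : b ≤ 2 * s + 1)
    (hG : ({3 * s + 3, b - s - 1, b} : Finset ℕ) ∈ E) (hx : s + 1 ≤ x) (hxb : x ≤ b) :
    ∃ S ⊆ miss E (Finset.Icc 1 (3 * s + 2)),
      (∀ T ∈ S, x ∈ T ∧ T ⊆ insert x (Finset.Ioc b (3 * s + 2))) ∧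
      ∃ j ≤ 2 * s + 1 - b, (s + 1 + j) * (s + 1 + j) ≤
        2 * S.card + (2 * j + 1) * (2 * j) + (s + 1 + j) := by
  refine hE.exists_missing (W := Finset.Ioc b (3 * s + 2)) (r := 2 * s + 1 - b) ?_ ?_ ?_ ?_ ?_
  · intro z hz
    rw [Finset.mem_Ioc] at hz
    rw [Finset.mem_Icc]
    omega
  · rw [Finset.mem_Icc]
    omega
  · rw [Finset.mem_Ioc]
    omega
  · refine hE.not_hasMatching_link (v := b - s - 1) (b := b) hM (by omega) (by omega) (by omega) hG
      ?_ (by rw [Finset.mem_Ioc]; omega) ?_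
    · intro z hz
      rw [Finset.mem_Ioc] at hz ⊢
      omega
    · intro U hU _
      have h1 : ∀ y ≤ b, U ∩ Finset.Ioc (b - s - 1) y = ∅ := by
        intro y hy
        rw [Finset.eq_empty_iff_forall_notMem]
        intro z hz
        rw [Finset.mem_inter] at hz
        have h2 := Finset.mem_Ioc.1 (hU hz.1)
        have h3 := Finset.mem_Ioc.1 hz.2
        omega
      rw [h1 b le_rfl, h1 x hxb]
      simp only [Finset.card_empty]
      omega
  · rw [Nat.card_Ioc]
    omega

theorem linkBound_of_far_edge {q : ℕ} (ih : LinkBound q) (hq : 1 ≤ q) {E : Finset (Finset ℕ)}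
    (hE : Shifted E) {s : ℕ} (hs : s = q + 1) (hM : ¬ HasMatching E (s + 1))
    (h0 : ({3 * s + 3, 1, 3 * s + 2} : Finset ℕ) ∉ E) {v b : ℕ} (hv : 1 ≤ v) (hvs : v ≤ s)
    (hvb : v + b = 3 * s + 3) (hG : ({3 * s + 3, v, b} : Finset ℕ) ∈ E) :
    (s + 1) * (topGraph E s).card ≤ 2 * (miss E (Finset.Icc 1 (3 * s + 2))).card := by
  have hv2 : 2 ≤ v := by
    by_contra h
    have : v = 1 := by omega
    subst this
    exact h0 (by rwa [show b = 3 * s + 2 by omega] at hG)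
  obtain ⟨S, hS, hST, j, hj, hSj⟩ := hE.exists_missing (n := 3 * s + 2) (x := b)
    (W := (Finset.Ioc v (3 * s + 2)).erase b) (r := s - v) (M := 2 * s + 1)
    (by
      intro z hz
      rw [Finset.mem_erase, Finset.mem_Ioc] at hz
      rw [Finset.mem_Icc]
      omega)
    (by rw [Finset.mem_Icc]; omega) (by simp)
    (by
      refine hE.not_hasMatching_link (v := v) (b := b) hM (by omega) (by omega) (by omega) hG
        ?_ (by simp) ?_
      · intro z hz
        rw [Finset.mem_erase, Finset.mem_Ioc] at hz
        rw [Finset.mem_Ioc]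
        omega
      · intro U hU hUc
        have := Finset.card_le_card (Finset.inter_subset_left (s₁ := U) (s₂ := Finset.Ioc v b))
        omega)
    (by
      rw [Finset.card_erase_of_mem (by rw [Finset.mem_Ioc]; omega), Nat.card_Ioc]
      omega)
  have hg := two_mul_card_topGraph_le hE hM h0
  refine ih.remove_edge hq hE hs hM h0 hv (by omega) hG (by omega) hS
    (fun T hT => Or.inr (hST T hT).1) (N₁ := (Finset.Icc 1 (3 * s + 1)).erase v)
    (N₂ := (Finset.Icc 1 s).erase v) (D := 4 * s - 1) ?_ ?_ ?_ ?_
  · intro w hw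
    have := topGraph_subset hE h0 hw
    rw [pair_mem_powersetCard] at this
    exact Finset.mem_erase.2 ⟨this.1.symm, this.2.2⟩
  · intro w hwv hw
    have h1 := (mem_topGraph.1 hw).1
    rw [Finset.mem_erase, Finset.mem_Icc]
    refine ⟨hwv, h1.2.2.1, ?_⟩
    by_contra h2
    exact not_mem_of_perfect hE hM (hE.of_mem_topGraph hw (by omega) (by omega) (by omega)
      (by omega) (by omega))
  · rw [Finset.card_erase_of_mem (by rw [Finset.mem_Icc]; omega),
      Finset.card_erase_of_mem (by rw [Finset.mem_Icc]; omega), Nat.card_Icc, Nat.card_Icc]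
    omega
  · obtain ⟨t, rfl⟩ : ∃ t, s = t + 2 + j := ⟨s - 2 - j, by omega⟩
    have h1 : 4 * (t + 2 + j) - 1 = 4 * t + 4 * j + 7 := by omega
    rw [h1]
    nlinarith

theorem linkBound_of_middle_edge {q : ℕ} (ih : LinkBound q) (hq : 1 ≤ q) {E : Finset (Finset ℕ)}
    (hE : Shifted E) {s : ℕ} (hs : s = q + 1) (hM : ¬ HasMatching E (s + 1))
    (h0 : ({3 * s + 3, 1, 3 * s + 2} : Finset ℕ) ∉ E)
    (hG : ({3 * s + 3, s, 2 * s + 2} : Finset ℕ) ∈ E) :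
    (s + 1) * (topGraph E s).card ≤ 2 * (miss E (Finset.Icc 1 (3 * s + 2))).card := by
  set b := 2 * s + 2 with hb
  set W := (Finset.Ioc s (3 * s + 2)).erase b with hW
  set R := W.powersetCard 2 \ (Finset.Ioo s b).powersetCard 2 with hR
  have hRm : ∀ A ∈ R, A ⊆ W ∧ A.card = 2 ∧ b ∉ A ∧ insert b A ∉ E := by
    intro A hA
    rw [hR, Finset.mem_sdiff, Finset.mem_powersetCard, Finset.mem_powersetCard] at hA
    have hbA : b ∉ A := fun h => by simpa [hW] using hA.1.1 h
    refine ⟨hA.1.1, hA.1.2, hbA, fun h => ?_⟩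
    refine hE.not_hasMatching_link (x := b) (v := s) (b := b) (W := A) hM rfl (by omega)
      (by omega) hG (fun z hz => ?_) hbA (fun U hU hUc => ?_)
      (hasMatching_one (mem_link.2 ⟨Finset.mem_powersetCard.2 ⟨subset_rfl, hA.1.2⟩, h⟩))
    · have := hA.1.1 hz
      rw [hW, Finset.mem_erase, Finset.mem_Ioc] at this
      rw [Finset.mem_Ioc]
      omega
    · obtain ⟨z, hz, hz'⟩ : ∃ z ∈ A, z ∉ Finset.Ioo s b := by
        by_contra! h'
        exact hA.2 ⟨h', hA.1.2⟩
      have h1 := hA.1.1 hz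
      rw [hW, Finset.mem_erase, Finset.mem_Ioc] at h1
      rw [Finset.mem_Ioo] at hz'
      have h2 : U ∩ Finset.Ioc s b ⊆ A.erase z := by
        intro y hy
        rw [Finset.mem_inter, Finset.mem_Ioc] at hy
        rw [Finset.mem_erase]
        exact ⟨by omega, hU hy.1⟩
      have h3 := Finset.card_le_card h2
      rw [Finset.card_erase_of_mem hz, hA.1.2] at h3
      omega
  have hRc : 2 * R.card = 3 * s * s + s := by
    have h1 : (Finset.Ioo s b).powersetCard 2 ⊆ W.powersetCard 2 := by
      refine Finset.powersetCard_mono fun z hz => ?_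
      rw [Finset.mem_Ioo] at hz
      rw [hW, Finset.mem_erase, Finset.mem_Ioc]
      omega
    have h2 := Finset.card_sdiff_add_card_eq_card h1
    have h3 : W.card = 2 * s + 1 := by
      rw [hW, Finset.card_erase_of_mem (by rw [Finset.mem_Ioc]; omega), Nat.card_Ioc]
      omega
    have h4 : (Finset.Ioo s b).card = s + 1 := by
      rw [Nat.card_Ioo]
      omega
    rw [Finset.card_powersetCard, Finset.card_powersetCard, h3, h4] at h2
    have h5 : 2 * (2 * s + 1).choose 2 = (2 * s + 1) * (2 * s) := by
      rw [Nat.choose_two_right, Nat.mul_div_cancel' (Nat.even_mul_pred_self _).two_dvd]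
      simp
    have h6 : 2 * (s + 1).choose 2 = (s + 1) * s := by
      rw [Nat.choose_two_right, Nat.mul_div_cancel' (Nat.even_mul_pred_self _).two_dvd]
      simp
    nlinarith
  have hinj : (R.image (insert b)).card = R.card := by
    refine Finset.card_image_of_injOn fun A hA B hB hAB => ?_
    rw [← Finset.erase_insert (hRm A hA).2.2.1, ← Finset.erase_insert (hRm B hB).2.2.1]
    exact congrArg (Finset.erase · b) hAB
  have hg := two_mul_card_topGraph_le hE hM h0
  refine ih.remove_edge hq hE hs hM h0 (a := s) (b := b) (S := R.image (insert b)) (by omega)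
    (by omega) hG (by omega) ?_ ?_ (N₁ := (Finset.Icc 1 (3 * s + 1)).erase s)
    (N₂ := (Finset.Icc 1 s).erase s) (D := 4 * s - 1) ?_ ?_ ?_ ?_
  · intro T hT
    obtain ⟨A, hA, rfl⟩ := Finset.mem_image.1 hT
    obtain ⟨h1, h2, h3, h4⟩ := hRm A hA
    rw [mem_miss, Finset.card_insert_of_notMem h3]
    refine ⟨⟨Finset.insert_subset (by rw [Finset.mem_Icc]; omega) fun z hz => ?_, by omega⟩, h4⟩
    have := h1 hz
    rw [hW, Finset.mem_erase, Finset.mem_Ioc] at this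
    rw [Finset.mem_Icc]
    omega
  · intro T hT
    obtain ⟨A, hA, rfl⟩ := Finset.mem_image.1 hT
    exact Or.inr (by simp)
  · intro w hw
    have := topGraph_subset hE h0 hw
    rw [pair_mem_powersetCard] at this
    exact Finset.mem_erase.2 ⟨this.1.symm, this.2.2⟩
  · intro w hwv hw
    have h1 := (mem_topGraph.1 hw).1
    rw [Finset.mem_erase, Finset.mem_Icc]
    refine ⟨hwv, h1.2.2.1, ?_⟩
    by_contra h2
    exact not_mem_of_perfect hE hM (hE.of_mem_topGraph hw (by omega) (by omega) (by omega)
      (by omega) (by omega))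
  · rw [Finset.card_erase_of_mem (by rw [Finset.mem_Icc]; omega),
      Finset.card_erase_of_mem (by rw [Finset.mem_Icc]; omega), Nat.card_Icc, Nat.card_Icc]
    omega
  · rw [hinj]
    obtain ⟨t, rfl⟩ : ∃ t, s = t + 2 := ⟨s - 2, by omega⟩
    have h1 : 4 * (t + 2) - 1 = 4 * t + 7 := by omega
    rw [h1]
    nlinarith

theorem concave_bound {t r j : ℕ} (hj : j ≤ r) :
    0 ≤ (j : ℤ) * (2 * (t + 1 + r) - 3 * j - 1) ∨
      (r : ℤ) * (2 * (t + 1 + r) - 3 * r - 1) ≤ j * (2 * (t + 1 + r) - 3 * j - 1) := by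
  obtain ⟨e, rfl⟩ : ∃ e, r = j + e := ⟨r - j, by omega⟩
  push_cast
  have hj0 : (0 : ℤ) ≤ j := Nat.cast_nonneg j
  have he0 : (0 : ℤ) ≤ e := Nat.cast_nonneg e
  by_cases h : (0 : ℤ) ≤ 2 * (t + 1 + (j + e)) - 3 * j - 1
  · exact Or.inl (mul_nonneg hj0 h)
  · right
    have h1 : (0 : ℤ) ≤ j - 2 * t - 1 - 2 * e := by linarith
    nlinarith [mul_nonneg he0 h1, mul_nonneg he0 hj0, mul_nonneg he0 he0]

theorem linkBound_of_inner_edge {q : ℕ} (ih : LinkBound q) (hq : 1 ≤ q) {E : Finset (Finset ℕ)}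
    (hE : Shifted E) {s : ℕ} (hs : s = q + 1) (hM : ¬ HasMatching E (s + 1))
    (h0 : ({3 * s + 3, 1, 3 * s + 2} : Finset ℕ) ∉ E)
    (hrow : ∀ v y, 1 ≤ v → v ≤ s → v < y → {v, y} ∈ topGraph E s → y + v ≤ 3 * s + 2)
    (hG : ({3 * s + 3, s + 1, s + 2} : Finset ℕ) ∈ E) :
    (s + 1) * (topGraph E s).card ≤ 2 * (miss E (Finset.Icc 1 (3 * s + 2))).card := by
  have hperf := not_mem_of_perfect hE hM
  obtain ⟨b, hb1, hb2, hbG, hbmax⟩ : ∃ b, s + 2 ≤ b ∧ b ≤ 2 * s + 1 ∧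
      ({3 * s + 3, s + 1, b} : Finset ℕ) ∈ E ∧
      ∀ y, s + 1 < y → {s + 1, y} ∈ topGraph E s → y ≤ b := by
    let P : ℕ → Prop := fun y => s + 2 ≤ y ∧ ({3 * s + 3, s + 1, y} : Finset ℕ) ∈ E
    classical
    have hP : P (s + 2) := ⟨le_rfl, hG⟩
    have h1 := Nat.findGreatest_spec (P := P) (n := 3 * s + 2) (by omega) hP
    refine ⟨Nat.findGreatest P (3 * s + 2), h1.1, ?_, h1.2, fun y hy hyG => ?_⟩
    · by_contra h2
      exact hperf (hE.triple (by omega) (by omega) (Nat.lt_succ_of_le (Nat.findGreatest_le _))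
        (by omega) (by omega) le_rfl (by omega) le_rfl h1.2)
    · have h3 := mem_topGraph.1 hyG
      exact Nat.le_findGreatest h3.1.2.2.2 ⟨hy, h3.2⟩
  obtain ⟨r, hr⟩ : ∃ r, b + r = 2 * s + 1 := ⟨2 * s + 1 - b, by omega⟩
  obtain ⟨ρ, hρr, hρ⟩ : ∃ ρ ≤ r, ({3 * s + 3, ρ + 1, 2 * s + 2 - ρ} : Finset ℕ) ∉ E := by
    by_contra! hall
    have hall' : ∀ i ≤ s, ({3 * s + 3, i + 1, 2 * s + 2 - i} : Finset ℕ) ∈ E := by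
      intro i hi
      by_cases hir : i ≤ r
      · exact hall i hir
      · exact hE.triple (by omega) (by omega : s + 1 < b) (by omega) (by omega) (by omega)
          (by omega) (by omega) le_rfl hbG
    refine not_hasMatching_topGraph hE hM (HasMatching.of_fintype
      (fun i : Fin (s + 1) => ({i.1 + 1, 2 * s + 2 - i.1} : Finset ℕ)) (fun i => ?_) ?_ (by simp))
    · have := i.2
      rw [mem_topGraph]
      exact ⟨by omega, hall' _ (by omega)⟩
    · intro i j hij
      have h9 := Fin.val_ne_of_ne hij
      have h10 := i.2
      have h11 := j.2
      simp only [Finset.disjoint_insert_left, Finset.disjoint_singleton_left, Finset.mem_insert,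
        Finset.mem_singleton, not_or]
      refine ⟨⟨?_, ?_⟩, ?_, ?_⟩ <;> omega
  have hmid : ∀ v y, ρ < v → v ≤ s → v < y → {v, y} ∈ topGraph E s → y ≤ 2 * s + 1 - ρ := by
    intro v y hv hvs hvy h
    by_contra h'
    exact hρ (hE.of_mem_topGraph h (by omega) (by omega) (by omega) (by omega) (by omega))
  have hhigh : ∀ v y, s < v → v < y → {v, y} ∈ topGraph E s → y ≤ b := by
    intro v y hv hvy h
    have h1 := (mem_topGraph.1 h).1
    refine hbmax y (by omega) (mem_topGraph.2 ⟨by omega, ?_⟩)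
    exact hE.of_mem_topGraph h (by omega) (by omega) (by omega) (by omega) (by omega)
  have hsub : topGraph E s ⊆ (Finset.Icc 1 (3 * s + 2)).powersetCard 2 := Finset.filter_subset _ _
  have hl1 := card_low_le hsub (fun v => 2 * v * (3 * s + 1 - v)) (fun v => 3 * s + 2 - v)
    (Nat.zero_le ρ) (fun x _ hx => ⟨by omega, by
      rw [Nat.cast_sub (by omega)]; push_cast; nlinarith⟩) (fun x y h1 h2 h3 h4 => by
      have := hrow x y h1 (by omega) h3 h4
      omega)
  have hl2 := card_low_le hsub (fun v => 2 * (2 * s + 1 - ρ) * v - v * (v + 1))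
    (fun v => 2 * s + 1 - ρ) (by omega : ρ ≤ s) (fun x _ hx => ⟨by omega, by
      rw [Nat.cast_sub (by omega)]; push_cast; nlinarith⟩) hmid
  have hl3 := card_low_le hsub (fun v => 2 * b * v - v * (v + 1))
    (fun v => b) (by omega : s ≤ b) (fun x _ hx => ⟨by omega, by push_cast; nlinarith⟩)
    (fun x y h1 _ => hhigh x y h1)
  rw [low_eq_self (k := b) (fun x y hx hxy hy h => by
    by_cases hxs : x ≤ s
    · omega
    · have := hhigh x y (by omega) hxy (mem_topGraph.2 ⟨by omega, h⟩)
      omega)] at hl3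
  rw [low_zero] at hl1
  have hlow : ({3 * s + 3, b - s - 1, b} : Finset ℕ) ∈ E :=
    hE.triple (by omega) (by omega : s + 1 < b) (by omega) (by omega) (by omega) (by omega)
      le_rfl le_rfl hbG
  obtain ⟨S₁, hS₁, hT₁, i, hi, hSi⟩ := hE.exists_missing_above (x := s + 1) hM hb1 hb2 hlow le_rfl
    (by omega)
  obtain ⟨S₂, hS₂, hT₂, j, hj, hSj⟩ := hE.exists_missing_above (x := b) hM hb1 hb2 hlow (by omega)
    le_rfl
  have hdisj : Disjoint S₁ S₂ := by
    rw [Finset.disjoint_left]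
    intro T h1 h2
    have := (hT₂ T h2).2 (hT₁ T h1).1
    rw [Finset.mem_insert, Finset.mem_Ioc] at this
    omega
  refine ih.remove_edge hq hE hs hM h0 (a := s + 1) (b := b) (S := S₁ ∪ S₂) (by omega)
    (by omega) hbG (by omega) (Finset.union_subset hS₁ hS₂) ?_
    (N₁ := (Finset.Icc 1 b).erase (s + 1))
    (N₂ := ((Finset.Icc 1 b).erase (s + 1)).erase b) (D := 2 * b - 3) ?_ ?_ ?_ ?_
  · intro T hT
    rcases Finset.mem_union.1 hT with h | h
    · exact Or.inl (hT₁ T h).1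
    · exact Or.inr (hT₂ T h).1
  · intro w hw
    have h1 := (mem_topGraph.1 hw).1
    rw [Finset.mem_erase, Finset.mem_Icc]
    refine ⟨h1.1.symm, h1.2.2.1, ?_⟩
    by_cases hws : w ≤ s
    · omega
    · exact hbmax w (by omega) hw
  · intro w hwv hw
    have h1 := (mem_topGraph.1 hw).1
    rw [Finset.mem_erase, Finset.mem_erase, Finset.mem_Icc]
    refine ⟨h1.1.symm, hwv, h1.2.2.1, ?_⟩
    by_contra h2
    exact h2 (hhigh b w (by omega) (by omega) hw)
  · rw [Finset.card_erase_of_mem (s := Finset.Icc 1 b) (by rw [Finset.mem_Icc]; omega),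
      Finset.card_erase_of_mem (by rw [Finset.mem_erase, Finset.mem_Icc]; omega),
      Finset.card_erase_of_mem (by rw [Finset.mem_Icc]; omega), Nat.card_Icc]
    omega
  · rw [Finset.card_union_of_disjoint hdisj]
    have hr1 : 2 * s + 1 - b = r := by omega
    rw [hr1] at hi hj
    have hb' : b = 2 * s + 1 - r := by omega
    have hrs : r + 1 ≤ s := by omega
    have hD : 2 * b - 3 = 4 * s - 1 - 2 * r := by omega
    rw [hD]
    obtain ⟨t, rfl⟩ : ∃ t, s = t + 1 + r := ⟨s - 1 - r, by omega⟩
    have hD' : 4 * (t + 1 + r) - 1 - 2 * r = 4 * t + 2 * r + 3 := by omega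
    rw [hD']
    have hbt : b = 2 * t + 3 + r := by omega
    rw [hbt] at hl3
    simp only [Finset.card_empty] at hl1
    push_cast at hl1 hl2 hl3
    have hci := concave_bound (t := t) hi
    have hcj := concave_bound (t := t) hj
    zify at hSi hSj hρr ⊢
    have hr0 : (0 : ℤ) ≤ r := Nat.cast_nonneg r
    have ht0 : (0 : ℤ) ≤ t := Nat.cast_nonneg t
    have hρ0 : (0 : ℤ) ≤ ρ := Nat.cast_nonneg ρ
    have hrt := mul_nonneg hr0 ht0
    have hrr := mul_nonneg hr0 hr0
    have htt := mul_nonneg ht0 ht0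
    have hρ2 : (ρ : ℤ) * ρ ≤ r * r := mul_le_mul hρr hρr hρ0 hr0
    have hg : 2 * ((topGraph E (t + 1 + r)).card : ℤ) ≤ 4 * (t + 1 + r) * (t + 1 + r) +
        2 * (t + 1 + r) + 2 * r * r - 2 * r * (t + 1 + r) := by
      linarith
    rcases hci with hci | hci <;> rcases hcj with hcj | hcj <;> linarith

theorem exists_missing_seven {E : Finset (Finset ℕ)} (hE : Shifted E)
    (hM : ¬ HasMatching E 3) (h23 : ({9, 2, 3} : Finset ℕ) ∈ E) (h17 : ({9, 1, 7} : Finset ℕ) ∈ E) :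
    ∃ S ⊆ miss E (Finset.Icc 1 8), (∀ T ∈ S, 7 ∈ T) ∧ S.card = 6 := by
  refine ⟨(({4, 5, 6, 8} : Finset ℕ).powersetCard 2).image (insert 7), ?_, ?_, by decide⟩
  · intro T hT
    obtain ⟨A, hA, rfl⟩ := Finset.mem_image.1 hT
    obtain ⟨y, z, hyz, hy, hz, rfl⟩ := mem_powersetCard_two hA
    simp only [Finset.mem_insert, Finset.mem_singleton] at hy hz
    have hc : (insert 7 ({y, z} : Finset ℕ)).card = 3 := by
      rw [Finset.card_insert_of_notMem (by simp; omega), Finset.card_pair hyz.ne]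
    refine mem_miss.2 ⟨⟨?_, hc⟩, fun h => ?_⟩
    · intro x hx
      simp only [Finset.mem_insert, Finset.mem_singleton] at hx
      rw [Finset.mem_Icc]
      omega
    obtain ⟨d, hd1, hd2, hdy⟩ : ∃ d, 4 ≤ d ∧ d ≤ 6 ∧ d ≠ y ∧ d ≠ z := by
      by_cases h4 : y = 4
      · by_cases h5 : z = 5
        · exact ⟨6, by omega⟩
        · exact ⟨5, by omega⟩
      · exact ⟨4, by omega⟩
    obtain ⟨e, he1, he2, hey⟩ : ∃ e, 4 ≤ e ∧ e ≤ 7 ∧ e ≠ y ∧ e ≠ z ∧ e ≠ d := by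
      exact ⟨7, by omega⟩
    refine hM (hasMatching_of_pairs (fun b : Bool => if b then {2, 3} else {1, d})
      (fun _ : Unit => {y, z}) (Finset.Icc 1 9) (Finset.Icc 1 7) (by simp) (by simp) ?_ ?_ ?_ ?_ ?_
      ?_ ?_ ?_)
    · rintro (_ | _)
      · exact Finset.card_pair (by omega)
      · rfl
    · exact fun _ => Finset.card_pair hyz.ne
    · rintro (_ | _) (_ | _) hij <;> simp at hij ⊢ <;> omega
    · exact fun i j hij => absurd rfl hij
    · rintro (_ | _) _ <;> simp <;> omega
    · rintro (_ | _) c hc hcA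
      · rw [Finset.mem_Icc] at hc
        refine hE _ 9 c (by simp; omega) hcA hc.1 hc.2 ?_
        exact hE.triple (by omega) (by omega : 1 < 7) (by omega) (by omega) (by omega) le_rfl
          (by omega) le_rfl h17
      · rw [Finset.mem_Icc] at hc
        exact hE _ 9 c (by simp) hcA hc.1 hc.2 h23
    · intro _ c hc hcA
      rw [Finset.mem_Icc] at hc
      exact hE _ 7 c (by simp; omega) hcA hc.1 hc.2 h
    · rw [Fintype.card_unit, Nat.one_le_iff_ne_zero, Finset.card_ne_zero]
      refine ⟨7, ?_⟩
      simp only [Finset.mem_sdiff, Finset.mem_Icc, Finset.mem_union, Finset.mem_biUnion,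
        Finset.mem_univ, true_and, not_or, not_exists]
      refine ⟨by omega, ?_, ?_⟩
      · rintro (_ | _)
        · simp
          omega
        · simp
      · rintro _
        simp
        omega
  · intro T hT
    obtain ⟨A, hA, rfl⟩ := Finset.mem_image.1 hT
    simp

theorem linkBound_of_no_inner_edge {q : ℕ} (ih : LinkBound q) (hq : 1 ≤ q)
    {E : Finset (Finset ℕ)} (hE : Shifted E) {s : ℕ} (hs : s = q + 1)
    (hM : ¬ HasMatching E (s + 1)) (h0 : ({3 * s + 3, 1, 3 * s + 2} : Finset ℕ) ∉ E)
    (hrow : ∀ v y, 1 ≤ v → v ≤ s → v < y → {v, y} ∈ topGraph E s → y + v ≤ 3 * s + 2)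
    (hrow' : ({3 * s + 3, s, 2 * s + 2} : Finset ℕ) ∉ E)
    (hG : ({3 * s + 3, s + 1, s + 2} : Finset ℕ) ∉ E)
    (hne : ({3 * s + 3, 1, 2} : Finset ℕ) ∈ E) :
    (s + 1) * (topGraph E s).card ≤ 2 * (miss E (Finset.Icc 1 (3 * s + 2))).card := by
  obtain ⟨a, ha1, has, haG, hnext⟩ : ∃ a, 1 ≤ a ∧ a ≤ s ∧
      ({3 * s + 3, a, a + 1} : Finset ℕ) ∈ E ∧ ({3 * s + 3, a + 1, a + 2} : Finset ℕ) ∉ E := by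
    let P : ℕ → Prop := fun y => 1 ≤ y ∧ ({3 * s + 3, y, y + 1} : Finset ℕ) ∈ E
    classical
    have h1 := Nat.findGreatest_spec (P := P) (m := 1) (n := s) (by omega) ⟨le_rfl, hne⟩
    refine ⟨Nat.findGreatest P s, h1.1, Nat.findGreatest_le _, h1.2, fun h => ?_⟩
    rcases (Nat.findGreatest_le (P := P) s).lt_or_eq with h2 | h2
    · exact Nat.findGreatest_is_greatest (P := P) (Nat.lt_succ_self _) h2 ⟨by omega, h⟩
    · rw [h2] at h
      exact hG h
  obtain ⟨b, hab, hbG, hbmax⟩ : ∃ b, a < b ∧ {a, b} ∈ topGraph E s ∧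
      ∀ y, a < y → {a, y} ∈ topGraph E s → y ≤ b := by
    let P : ℕ → Prop := fun y => a < y ∧ {a, y} ∈ topGraph E s
    classical
    have h1 := Nat.findGreatest_spec (P := P) (m := a + 1) (n := 3 * s + 2) (by omega)
      ⟨by omega, mem_topGraph.2 ⟨by omega, haG⟩⟩
    exact ⟨Nat.findGreatest P (3 * s + 2), h1.1, h1.2, fun y hy h =>
      Nat.le_findGreatest (mem_topGraph.1 h).1.2.2.2 ⟨hy, h⟩⟩
  have hbE := (mem_topGraph.1 hbG).2
  have habs := hrow a b ha1 has hab hbG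
  have hno : ∀ v y, v < y → {v, y} ∈ topGraph E s → v ≤ a := by
    intro v y hvy h
    by_contra h'
    exact hnext (hE.of_mem_topGraph h (by omega) (by omega) (by omega) (by omega) (by omega))
  have hsub : topGraph E s ⊆ (Finset.Icc 1 (3 * s + 2)).powersetCard 2 := Finset.filter_subset _ _
  have hl1 := card_low_le hsub (fun v => 2 * v * (3 * s + 1 - v)) (fun v => 3 * s + 2 - v)
    (Nat.zero_le (a - 1)) (fun x _ hx => ⟨by omega, by
      rw [Nat.cast_sub (by omega)]; push_cast; nlinarith⟩) (fun x y h1 h2 h3 h4 => by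
      have := hrow x y h1 (by omega) h3 h4
      omega)
  have hl2 := card_low_le hsub (fun v => 2 * (b - a) * v) (fun v => b) (by omega : a - 1 ≤ a)
    (fun x h1 h2 => ⟨by omega, by
      have : (a : ℤ) = x + 1 := by omega
      rw [this]; push_cast; nlinarith⟩)
    (fun x y h1 h2 h3 h4 => by
      have : x = a := by omega
      subst this
      exact hbmax y h3 h4)
  rw [low_eq_self (k := a) (fun x y hx hxy hy h => hno x y hxy (mem_topGraph.2 ⟨by omega, h⟩))]
    at hl2
  rw [low_zero, Finset.card_empty] at hl1
  have hg : ((topGraph E s).card : ℤ) ≤ (a - 1) * (3 * s + 2 - a) + b - a := by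
    push_cast [Nat.cast_sub ha1] at hl1 hl2
    linarith
  have hfin : ∀ S ⊆ miss E (Finset.Icc 1 (3 * s + 2)), (∀ T ∈ S, a ∈ T ∨ b ∈ T) →
      3 * ((topGraph E s).card : ℤ) + (s - 2) * (a + b - 2) + 9 * s ≤ 2 * S.card + 9 * s * s + 2 →
      (s + 1) * (topGraph E s).card ≤ 2 * (miss E (Finset.Icc 1 (3 * s + 2))).card := by
    intro S hS hT hK
    refine ih.remove_edge hq hE hs hM h0 ha1 hab hbE (by omega) hS hT
      (N₁ := (Finset.Icc 1 b).erase a) (N₂ := Finset.Icc 1 (a - 1)) (D := a + b - 2) ?_ ?_ ?_ ?_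
    · intro w hw
      have h1 := (mem_topGraph.1 hw).1
      rw [Finset.mem_erase, Finset.mem_Icc]
      refine ⟨h1.1.symm, h1.2.2.1, ?_⟩
      by_cases hwa : w ≤ a
      · omega
      · exact hbmax w (by omega) hw
    · intro w hwa hw
      have h1 := (mem_topGraph.1 hw).1
      rw [Finset.mem_Icc]
      refine ⟨h1.2.2.1, ?_⟩
      by_contra h'
      exact hnext (hE.of_mem_topGraph hw (by omega) (by omega) (by omega) (by omega) (by omega))
    · rw [Finset.card_erase_of_mem (by rw [Finset.mem_Icc]; omega), Nat.card_Icc, Nat.card_Icc]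
      omega
    · zify [show 2 ≤ a + b by omega]
      linarith
  have hempty := hfin ∅ (Finset.empty_subset _) (by simp)
  rw [Finset.card_empty] at hempty
  rcases (show a + 2 ≤ s ∨ s = a + 1 ∨ s = a by omega) with h | h | h
  · refine hempty ?_
    obtain ⟨c, rfl⟩ : ∃ c, s = a + 2 + c := ⟨s - a - 2, by omega⟩
    obtain ⟨d, hd⟩ : ∃ d, b + d = 3 * (a + 2 + c) + 2 - a := ⟨3 * (a + 2 + c) + 2 - a - b, by omega⟩
    have hb : (b : ℤ) = 3 * (a + 2 + c) + 2 - a - d := by omega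
    rw [hb] at hg ⊢
    push_cast at hg ⊢
    nlinarith [mul_nonneg (Nat.cast_nonneg (α := ℤ) a) (Nat.cast_nonneg (α := ℤ) d),
      mul_nonneg (Nat.cast_nonneg (α := ℤ) c) (Nat.cast_nonneg (α := ℤ) d),
      mul_nonneg (Nat.cast_nonneg (α := ℤ) a) (Nat.cast_nonneg (α := ℤ) c),
      mul_nonneg (Nat.cast_nonneg (α := ℤ) c) (Nat.cast_nonneg (α := ℤ) c)]
  · subst h
    by_cases hb : b ≤ 2 * (a + 1)
    · refine hempty ?_
      zify at hb
      push_cast at hg ⊢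
      nlinarith
    obtain ⟨S, hS, hST, j, hj, hSj⟩ := hE.exists_missing (n := 3 * (a + 1) + 2) (x := b)
      (W := (Finset.Icc (2 * (a + 1)) (3 * (a + 1) + 2)).erase b) (r := 1) (M := a + 2)
      (by
        intro z hz
        rw [Finset.mem_erase, Finset.mem_Icc] at hz
        rw [Finset.mem_Icc]
        omega)
      (by rw [Finset.mem_Icc]; omega) (by simp)
      (by
        refine hE.not_hasMatching_link (v := a) (b := b) hM (by omega) (by omega) (by omega) hbE
          ?_ (by simp) ?_
        · intro z hz
          rw [Finset.mem_erase, Finset.mem_Icc] at hz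
          rw [Finset.mem_Ioc]
          omega
        · intro U hU hUc
          have h1 : U ∩ Finset.Ioc a b ⊆ Finset.Ico (2 * (a + 1)) b := by
            intro z hz
            rw [Finset.mem_inter, Finset.mem_Ioc] at hz
            have h2 := hU hz.1
            rw [Finset.mem_erase, Finset.mem_Icc] at h2
            rw [Finset.mem_Ico]
            omega
          have h2 := Finset.card_le_card h1
          rw [Nat.card_Ico] at h2
          omega)
      (by
        rw [Finset.card_erase_of_mem (by rw [Finset.mem_Icc]; omega), Nat.card_Icc]
        omega)
    refine hfin S hS (fun T hT => Or.inr (hST T hT).1) ?_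
    have hb' : b ≤ 2 * a + 5 := by omega
    zify at hb' hSj
    interval_cases j <;> push_cast at * <;> nlinarith
  · subst h
    have hb2 : b ≤ 2 * s + 1 := by
      by_contra h
      exact hrow' (hE.triple (by omega) hab (by omega) (by omega) (by omega) le_rfl (by omega)
        le_rfl hbE)
    by_cases h17 : s = 2 ∧ ({3 * s + 3, 1, 7} : Finset ℕ) ∈ E
    · obtain ⟨rfl, h17⟩ := h17
      obtain ⟨S, hS, hS7, hSc⟩ := exists_missing_seven hE hM haG h17
      refine ih.remove_edge hq hE hs hM h0 (a := 1) (b := 7) le_rfl (by omega) h17 (by omega) hS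
        (fun T hT => Or.inr (hS7 T hT)) (N₁ := Finset.Icc 1 9) (N₂ := Finset.Icc 1 9) (D := 18)
        ?_ ?_ (by simp) ?_
      · intro w hw
        have h1 := (mem_topGraph.1 hw).1
        rw [Finset.mem_Icc]
        omega
      · intro w hwa hw
        have h1 := (mem_topGraph.1 hw).1
        rw [Finset.mem_Icc]
        omega
      · zify
        rw [hSc]
        push_cast at hg ⊢
        linarith
    have hg2 : s = 2 → ((topGraph E s).card : ℤ) ≤ b + 3 := by
      rintro rfl
      have hl3 := card_low_le hsub (fun v => 10 * v) (fun _ => 6) (Nat.zero_le 1)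
        (fun x _ hx => ⟨by omega, by
          have : x = 0 := by omega
          subst this
          norm_num⟩) (fun x y h1 h2 h3 h4 => by
          by_contra h5
          exact h17 ⟨rfl, hE.of_mem_topGraph h4 le_rfl (by omega) h1 (by omega) (by omega)⟩)
      rw [low_zero, Finset.card_empty] at hl3
      norm_num at hl2 hl3
      linarith
    obtain ⟨r, hr⟩ : ∃ r, b + r = 2 * s + 1 := ⟨2 * s + 1 - b, by omega⟩
    have hbr : (b : ℤ) = 2 * s + 1 - r := by omega
    by_cases hrs : r = s
    · by_cases hs3 : 3 ≤ s
      · refine hempty ?_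
        rw [hbr] at hg ⊢
        subst hrs
        zify at hs3
        nlinarith
      · obtain rfl : s = 2 := by omega
        refine hempty ?_
        have := hg2 rfl
        rw [hbr, hrs] at this ⊢
        push_cast at this ⊢
        linarith
    · obtain ⟨S, hS, hST, j, hj, hSj⟩ := hE.exists_missing_above (x := b) hM (by omega) hb2
        (hE.triple (by omega) hab (by omega) (by omega) (by omega) (by omega) le_rfl le_rfl hbE)
        (by omega) le_rfl
      rw [show 2 * s + 1 - b = r by omega] at hj
      by_cases hs3 : 3 ≤ s
      · refine hfin S hS (fun T hT => Or.inr (hST T hT).1) ?_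
        rw [hbr] at hg ⊢
        obtain ⟨t, rfl⟩ : ∃ t, s = t + 1 + r := ⟨s - 1 - r, by omega⟩
        have hc := concave_bound (t := t) hj
        zify at hSj hs3
        push_cast at hg ⊢
        have hr0 : (0 : ℤ) ≤ r := Nat.cast_nonneg r
        have ht0 : (0 : ℤ) ≤ t := Nat.cast_nonneg t
        rcases hc with hc | hc <;> nlinarith [mul_nonneg hr0 ht0, mul_nonneg hr0 hr0]
      · obtain rfl : s = 2 := by omega
        refine hfin S hS (fun T hT => Or.inr (hST T hT).1) ?_
        have := hg2 rfl
        have hb5 : (b : ℤ) ≤ 5 := by exact_mod_cast hb2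
        have hj1 : j ≤ 1 := by omega
        have hS6 : (6 : ℤ) ≤ 2 * S.card := by
          interval_cases j <;> omega
        push_cast at this ⊢
        linarith

theorem card_miss_insert {E : Finset (Finset ℕ)} {x : ℕ} {W : Finset ℕ} (hx : x ∉ W) :
    (miss E (insert x W)).card + (link E x W).card = (miss E W).card + W.card.choose 2 := by
  have hxA : ∀ A ∈ W.powersetCard 2, x ∉ A := fun A hA h => hx ((Finset.mem_powersetCard.1 hA).1 h)
  rw [miss, Finset.powersetCard_succ_insert hx, Finset.filter_union, Finset.card_union_of_disjoint,
    Finset.filter_image, Finset.card_image_of_injOn, ← miss, add_assoc, link,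
    add_comm (Finset.card _) (Finset.card (Finset.filter _ (Finset.powersetCard 2 W))),
    Finset.card_filter_add_card_filter_not, Finset.card_powersetCard]
  · intro A hA B hB hAB
    simp only [Finset.coe_filter, Set.mem_ofPred_eq] at hA hB
    rw [← Finset.erase_insert (hxA A hA.1), ← Finset.erase_insert (hxA B hB.1)]
    exact congrArg (Finset.erase · x) hAB
  · rw [Finset.disjoint_left]
    intro A hA hA'
    obtain ⟨B, -, rfl⟩ := Finset.mem_image.1 (Finset.mem_filter.1 hA').1
    exact hx ((mem_miss.1 hA).1.1 (by simp))

theorem card_link_insert_le {E : Finset (Finset ℕ)} {t x : ℕ} {W : Finset ℕ} :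
    (link E t (insert x W)).card ≤
      (link E t W).card + (W.filter fun y => {t, x, y} ∈ E).card := by
  refine (Finset.card_le_card (t := link E t W ∪ (W.filter fun y => {t, x, y} ∈ E).image
    fun y => {x, y}) ?_).trans ((Finset.card_union_le _ _).trans
      (Nat.add_le_add_left Finset.card_image_le _))
  intro A hA
  obtain ⟨hA, hE⟩ := mem_link.1 hA
  obtain ⟨y, z, hyz, hy, hz, rfl⟩ := mem_powersetCard_two hA
  rw [Finset.mem_union, mem_link, pair_mem_powersetCard, Finset.mem_image]
  rw [Finset.mem_insert] at hy hz
  rcases hy with rfl | hy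
  · exact Or.inr ⟨z, Finset.mem_filter.2 ⟨hz.resolve_left hyz.ne', hE⟩, rfl⟩
  · rcases hz with rfl | hz
    · rw [Finset.pair_comm] at hE ⊢
      exact Or.inr ⟨y, Finset.mem_filter.2 ⟨hy, hE⟩, rfl⟩
    · exact Or.inl ⟨⟨hyz.ne, hy, hz⟩, hE⟩

theorem map_add_one_Icc (n : ℕ) :
    (Finset.Icc 1 n).map (addRightEmbedding 1) = Finset.Icc 2 (n + 1) :=
  Finset.map_add_right_Icc 1 n 1

theorem linkBound_of_top_edge {q : ℕ} (ih : LinkBound q) (hq : 1 ≤ q)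
    {E : Finset (Finset ℕ)} (hE : Shifted E) {s : ℕ} (hs : s = q + 1)
    (hM : ¬ HasMatching E (s + 1)) (h1 : ({3 * s + 3, 1, 3 * s + 2} : Finset ℕ) ∈ E) :
    (s + 1) * (topGraph E s).card ≤ 2 * (miss E (Finset.Icc 1 (3 * s + 2))).card := by
  have hM' : ¬ HasMatching (E.filter fun A => A ⊆ Finset.Icc 2 (3 * s + 1)) s := by
    rintro ⟨f, hf, hd⟩
    simp only [Finset.mem_filter] at hf
    refine hM (HasMatching.of_option f (fun i => (hf i).1) hd h1 (fun i => ?_) (by simp))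
    rw [Finset.disjoint_left]
    intro x hx hx'
    have := Finset.mem_Icc.1 ((hf i).2 hx')
    simp only [Finset.mem_insert, Finset.mem_singleton] at hx
    omega
  set W := Finset.Icc 2 (3 * s) with hW
  have hWc : W.card = 3 * s - 1 := by simp [hW]
  have hWC : insert (3 * s + 2) (insert (3 * s + 1) W) = Finset.Icc 2 (3 * s + 2) := by
    ext; simp [hW]; omega
  have hWD : insert 1 (insert (3 * s + 2) (insert (3 * s + 1) W)) = Finset.Icc 1 (3 * s + 2) := by
    ext; simp [hW]; omega
  have hx1 : 3 * s + 1 ∉ W := by simp [hW]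
  have hx2 : 3 * s + 2 ∉ insert (3 * s + 1) W := by simp [hW]
  -- the induction hypothesis on `[2, 3s + 1]`
  have hlam : s * (link E (3 * s + 1) W).card ≤ 2 * (miss E W).card := by
    have h := ih.relabel hE (φ := addRightEmbedding 1) (fun x y h => by simpa using h) (by simp)
      (by
        rw [map_add_one_Icc]
        subst hs
        exact hM')
    rw [map_add_one_Icc] at h
    subst hs
    exact h
  have hlink : ∀ t, 3 * s + 1 ≤ t → link E (t + 1) W ⊆ link E t W := by
    intro t ht A hA
    rw [mem_link] at hA ⊢
    have hAW := (Finset.mem_powersetCard.1 hA.1).1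
    have h2 : ∀ x ∈ A, x ≤ 3 * s := fun x hx => (Finset.mem_Icc.1 (hAW hx)).2
    refine ⟨hA.1, hE A (t + 1) t (fun h => ?_) (fun h => ?_) (by omega) (by omega) hA.2⟩
    · have := h2 _ h
      omega
    · have := h2 _ h
      omega
  set D := W.filter fun y => ({3 * s + 2, 3 * s + 1, y} : Finset ℕ) ∈ E with hD
  have hDc : D.card ≤ s - 1 := by
    by_contra hc
    obtain ⟨y, hy, hys⟩ : ∃ y ∈ D, s + 1 ≤ y := by
      by_contra! h
      have h2 : D ⊆ Finset.Icc 2 s := by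
        intro y hy
        have h3 := h y hy
        have h4 := Finset.mem_Icc.1 (Finset.filter_subset _ _ hy)
        rw [Finset.mem_Icc]
        omega
      have h3 := Finset.card_le_card h2
      rw [Nat.card_Icc] at h3
      omega
    rw [hD, Finset.mem_filter, hW, Finset.mem_Icc, Finset.pair_comm] at hy
    refine hM' (HasMatching.of_fintype
      (fun i : Fin s => ({2 * s + 2 + i.1, i.1 + 2, s + 2 + i.1} : Finset ℕ)) (fun i => ?_)
      (fun i j hij => ?_) (by simp))
    · have := i.2
      rw [Finset.mem_filter]
      refine ⟨hE.triple (by omega) (by omega : y < 3 * s + 1) (by omega) (by omega) (by omega)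
        (by omega) (by omega) (by omega) hy.2, fun x hx => ?_⟩
      simp only [Finset.mem_insert, Finset.mem_singleton] at hx
      rw [Finset.mem_Icc]
      omega
    · have h9 := Fin.val_ne_of_ne hij
      have h10 := i.2
      have h11 := j.2
      refine Finset.disjoint_left.2 ?_
      intro x hx hx'
      simp only [Finset.mem_insert, Finset.mem_singleton] at hx hx'
      omega
  have hD2 : ∀ y ∈ W, ∀ t, 3 * s + 1 ≤ t → ({3 * s + 3, t, y} : Finset ℕ) ∈ E → t ≤ 3 * s + 2 →
      y ∈ D := by
    intro y hy t ht hyE ht'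
    rw [hD, Finset.mem_filter, Finset.pair_comm]
    rw [Finset.pair_comm] at hyE
    have := Finset.mem_Icc.1 hy
    exact ⟨hy, hE.triple (by omega) (by omega : y < t) (by omega) (by omega) (by omega) le_rfl ht
      (by omega) hyE⟩
  have htop : ({3 * s + 3, 3 * s + 2, 3 * s + 1} : Finset ℕ) ∉ E := by
    intro h
    rw [Finset.pair_comm] at h
    have h2 : W ⊆ D := fun y hy => by
      have := Finset.mem_Icc.1 hy
      refine hD2 y hy (3 * s + 1) le_rfl ?_ (by omega)
      rw [Finset.pair_comm]
      exact hE.triple (by omega) (by omega) (by omega) (by omega) (by omega) (by omega) (by omega)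
        le_rfl h
    have h3 := Finset.card_le_card h2
    omega
  have hD3 : ((insert (3 * s + 1) W).filter fun y => ({3 * s + 3, 3 * s + 2, y} : Finset ℕ) ∈ E)
      ⊆ D := by
    intro y hy
    rw [Finset.mem_filter, Finset.mem_insert] at hy
    rcases hy with ⟨rfl | hy, hyE⟩
    · exact absurd hyE htop
    · exact hD2 y hy _ (by omega) hyE le_rfl
  have hD4 : (W.filter fun y => ({3 * s + 3, 3 * s + 1, y} : Finset ℕ) ∈ E) ⊆ D := fun y hy =>
    hD2 y (Finset.mem_filter.1 hy).1 _ le_rfl (Finset.mem_filter.1 hy).2 (by omega)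
  have hg : (topGraph E s).card ≤ 3 * s + 1 + (link E (3 * s + 2) W).card + 2 * D.card := by
    have e1 := card_link_insert_le (E := E) (t := 3 * s + 3) (x := 3 * s + 1) (W := W)
    have e2 := card_link_insert_le (E := E) (t := 3 * s + 3) (x := 3 * s + 2)
      (W := insert (3 * s + 1) W)
    have e3 := card_link_insert_le (E := E) (t := 3 * s + 3) (x := 1)
      (W := insert (3 * s + 2) (insert (3 * s + 1) W))
    have e4 : (link E (3 * s + 3) W).card ≤ _ := Finset.card_le_card (hlink (3 * s + 2) (by omega))
    have e5 := Finset.card_le_card hD3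
    have e6 := Finset.card_le_card hD4
    have e7 := Finset.card_filter_le (insert (3 * s + 2) (insert (3 * s + 1) W))
      fun y => ({3 * s + 3, 1, y} : Finset ℕ) ∈ E
    rw [hWC, Nat.card_Icc] at e7
    rw [hWD, hWC] at e3
    rw [hWC] at e2
    rw [topGraph]
    omega
  have hm1 := card_miss_insert (E := E) hx1
  have hm2 := card_miss_insert (E := E) hx2
  have hm3 : (miss E (insert (3 * s + 2) (insert (3 * s + 1) W))).card ≤
      (miss E (Finset.Icc 1 (3 * s + 2))).card := by
    rw [← hWD]
    exact Finset.card_le_card (Finset.filter_subset_filter _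
      (Finset.powersetCard_mono (Finset.subset_insert _ _)))
  have hl2 := card_link_insert_le (E := E) (t := 3 * s + 2) (x := 3 * s + 1) (W := W)
  have hl1 := Finset.card_le_card (hlink (3 * s + 1) le_rfl)
  obtain ⟨i, j, hij, hEG⟩ := card_le_of_pairStable q W (link E (3 * s + 2) W)
    (Finset.filter_subset _ _)
    (hE.pairStable_link (by simp [hW]) fun x hx => by
      have := Finset.mem_Icc.1 hx
      omega)
    (by
      rw [← hs]
      rintro ⟨P, hP, hPd⟩
      simp only [mem_link, Finset.mem_powersetCard] at hP
      refine hM' (hasMatching_of_pairs P (fun i : Fin 0 => i.elim0) (Finset.Icc 2 (3 * s + 1)) ∅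
        (by simp) (by simp) (fun i => (hP i).1.2) (fun i => i.elim0) hPd (fun i => i.elim0)
        (fun _ i => i.elim0) (fun i c hc hci => ?_) (fun i => i.elim0) (by simp))
      have hc' := Finset.mem_Icc.1 hc
      rw [Finset.mem_filter]
      refine ⟨hE _ _ c (fun h => ?_) hci (by omega) (by omega) (hP i).2,
        Finset.insert_subset hc ((hP i).1.1.trans (Finset.Icc_subset_Icc le_rfl (by omega)))⟩
      have := Finset.mem_Icc.1 ((hP i).1.1 h)
      omega)
  rw [Finset.card_insert_of_notMem hx1] at hm2
  rw [hWc] at hm1 hm2 hEG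
  rw [← hD] at hl2
  have hc1 : 2 * (3 * s - 1).choose 2 = (3 * s - 1) * (3 * s - 2) := by
    rw [Nat.choose_two_right, Nat.mul_div_cancel' (Nat.even_mul_pred_self _).two_dvd]
    rfl
  have hc2 : 2 * (3 * s - 1 + 1).choose 2 = 3 * s * (3 * s - 1) := by
    rw [Nat.choose_two_right, Nat.mul_div_cancel' (Nat.even_mul_pred_self _).two_dvd]
    rw [show 3 * s - 1 + 1 = 3 * s by omega]
  obtain ⟨p, rfl⟩ : ∃ p, q = p + 1 := ⟨q - 1, by omega⟩
  have k1 := Nat.mul_le_mul_left p hl1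
  have k2 := Nat.mul_le_mul_left (s + 1) hg
  have k3 := Nat.mul_le_mul_left (s + 2) hDc
  subst hs
  have hsum : (p : ℤ) = i + j - 1 := by omega
  have n1 : (3 * (p + 1 + 1) - 1 : ℕ) = 3 * p + 5 := by omega
  have n2 : (3 * (p + 1 + 1) - 2 : ℕ) = 3 * p + 4 := by omega
  have n3 : (p + 1 + 1 - 1 : ℕ) = p + 1 := by omega
  rw [n1] at hm1 hm2 hEG hc1 hc2
  rw [n2] at hc1
  rw [n3] at k3
  zify at *
  nlinarith [mul_nonneg (Nat.cast_nonneg (α := ℤ) i) (Nat.cast_nonneg (α := ℤ) j),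
    mul_nonneg (Nat.cast_nonneg (α := ℤ) i) (Nat.cast_nonneg (α := ℤ) i),
    mul_nonneg (Nat.cast_nonneg (α := ℤ) j) (Nat.cast_nonneg (α := ℤ) j)]

theorem LinkBound.succ {q : ℕ} (ih : LinkBound q) (hq : 1 ≤ q) : LinkBound (q + 1) := by
  intro E hE hM
  obtain ⟨s, hs⟩ : ∃ s, s = q + 1 := ⟨_, rfl⟩
  rw [← hs] at hM ⊢
  by_cases h0 : ({3 * s + 3, 1, 3 * s + 2} : Finset ℕ) ∈ E
  · exact linkBound_of_top_edge ih hq hE hs hM h0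
  by_cases hne : ({3 * s + 3, 1, 2} : Finset ℕ) ∈ E
  swap
  · have : topGraph E s = ∅ := Finset.eq_empty_of_forall_notMem fun A hA => by
      obtain ⟨x, y, hx, hxy, hy, rfl, h⟩ := exists_of_mem_topGraph hA
      exact hne (hE.triple le_rfl hxy (by omega) (by omega) (by omega) hx (by omega) le_rfl h)
    simp [this]
  by_cases hfar : ∃ v, 1 ≤ v ∧ v ≤ s ∧ ({3 * s + 3, v, 3 * s + 3 - v} : Finset ℕ) ∈ E
  · obtain ⟨v, hv, hvs, h⟩ := hfar
    exact linkBound_of_far_edge ih hq hE hs hM h0 hv hvs (by omega) h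
  have hrow : ∀ v y, 1 ≤ v → v ≤ s → v < y → {v, y} ∈ topGraph E s → y + v ≤ 3 * s + 2 := by
    intro v y hv hvs hvy h
    by_contra hy
    exact hfar ⟨v, hv, hvs, hE.of_mem_topGraph h hv (by omega) le_rfl (by omega) (by omega)⟩
  by_cases hmid : ({3 * s + 3, s, 2 * s + 2} : Finset ℕ) ∈ E
  · exact linkBound_of_middle_edge ih hq hE hs hM h0 hmid
  by_cases hin : ({3 * s + 3, s + 1, s + 2} : Finset ℕ) ∈ E
  · exact linkBound_of_inner_edge ih hq hE hs hM h0 hrow hin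
  · exact linkBound_of_no_inner_edge ih hq hE hs hM h0 hrow hmid hin hne

theorem linkBound {s : ℕ} (hs : 1 ≤ s) : LinkBound s := by
  induction s, hs using Nat.le_induction with
  | base => exact linkBound_one
  | succ q hq ih => exact ih.succ hq

theorem exists_sorted_of_card_eq_three {A : Finset ℕ} (h : A.card = 3) :
    ∃ x y z, x < y ∧ y < z ∧ A = {z, x, y} := by
  obtain ⟨x, y, z, hxy, hxz, hyz, rfl⟩ := Finset.card_eq_three.1 h
  rcases lt_or_gt_of_ne hxy with h1 | h1 <;> rcases lt_or_gt_of_ne hxz with h2 | h2 <;>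
    rcases lt_or_gt_of_ne hyz with h3 | h3
  · exact ⟨x, y, z, h1, h3, by grind⟩
  · exact ⟨x, z, y, h2, h3, by grind⟩
  · omega
  · exact ⟨z, x, y, h2, h1, by grind⟩
  · exact ⟨y, x, z, h1, h2, by grind⟩
  · omega
  · exact ⟨y, z, x, h3, h2, by grind⟩
  · exact ⟨z, y, x, h3, h1, by grind⟩

/-- A matching in a shifted family can be moved onto an initial segment. -/
theorem Shifted.hasMatching_initial {E : Finset (Finset ℕ)} (hE : Shifted E) {n p : ℕ}
    (hEn : E ⊆ (Finset.Icc 1 n).powersetCard 3) (h : HasMatching E p) :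
    HasMatching (E.filter fun A => A ⊆ Finset.Icc 1 (3 * p)) p := by
  obtain ⟨f, hf, hd⟩ := h
  set U := Finset.univ.biUnion f with hU
  have hfE := fun i => Finset.mem_powersetCard.1 (hEn (hf i))
  have hUc : U.card ≤ 3 * p := by
    refine Finset.card_biUnion_le.trans ?_
    simp only [fun i => (hfE i).2]
    simp [mul_comm]
  have hU1 : ∀ x ∈ U, 1 ≤ x := by
    intro x hx
    obtain ⟨i, -, hi⟩ := Finset.mem_biUnion.1 hx
    exact (Finset.mem_Icc.1 ((hfE i).1 hi)).1
  have hfU : ∀ i, f i ⊆ U := fun i => Finset.subset_biUnion_of_mem f (Finset.mem_univ i)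
  let φ : ℕ → ℕ := fun x => (U.filter (· ≤ x)).card
  have hφ : ∀ x ∈ U, ∀ y ∈ U, x < y → φ x < φ y := by
    intro x hx y hy hxy
    refine Finset.card_lt_card (Finset.ssubset_iff_of_subset ?_ |>.2 ⟨y, ?_, ?_⟩)
    · exact Finset.monotone_filter_right _ fun z _ hz => le_trans hz hxy.le
    · simp [hy]
    · simp [hxy]
  have hφ1 : ∀ x ∈ U, 1 ≤ φ x := fun x hx => Finset.card_pos.2 ⟨x, by simp [hx]⟩
  have hφx : ∀ x, φ x ≤ x := fun x => by
    refine (Finset.card_le_card (t := Finset.Icc 1 x) fun z hz => ?_).trans (by simp)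
    rw [Finset.mem_filter] at hz
    exact Finset.mem_Icc.2 ⟨hU1 z hz.1, hz.2⟩
  have hinj : Set.InjOn φ U := by
    intro x hx y hy hxy
    rcases lt_trichotomy x y with h | h | h
    · exact absurd hxy (hφ x hx y hy h).ne
    · exact h
    · exact absurd hxy (hφ y hy x hx h).ne'
  refine ⟨fun i => (f i).image φ, fun i => Finset.mem_filter.2 ⟨?_, fun x hx => ?_⟩,
    fun i j hij => ?_⟩
  · obtain ⟨x, y, z, hxy, hyz, hA⟩ := exists_sorted_of_card_eq_three (hfE i).2
    have hx : x ∈ U := hfU i (by simp [hA])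
    have hy : y ∈ U := hfU i (by simp [hA])
    have hz : z ∈ U := hfU i (by simp [hA])
    have h := hA ▸ hf i
    simp only [hA, Finset.image_insert, Finset.image_singleton]
    exact hE.triple (hφ1 x hx) hxy hyz (hφ x hx y hy hxy) (hφ y hy z hz hyz) (hφx x) (hφx y)
      (hφx z) h
  · obtain ⟨y, hy, rfl⟩ := Finset.mem_image.1 hx
    exact Finset.mem_Icc.2 ⟨hφ1 y (hfU i hy), (Finset.card_filter_le _ _).trans hUc⟩
  · refine Finset.disjoint_left.2 fun x hx hx' => ?_
    obtain ⟨y, hy, rfl⟩ := Finset.mem_image.1 hx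
    obtain ⟨z, hz, hzy⟩ := Finset.mem_image.1 hx'
    have := hinj (hfU j hz) (hfU i hy) hzy
    subst this
    exact Finset.disjoint_left.1 (hd hij) hy hz

theorem six_mul_choose_three (n : ℕ) : (6 : ℤ) * n.choose 3 = n * (n - 1) * (n - 2) := by
  induction n with
  | zero => simp
  | succ n ih =>
    have h : (2 : ℤ) * n.choose 2 = n * (n - 1) := by
      rcases n with _ | k
      · simp
      · have h1 : 2 * (k + 1).choose 2 = (k + 1) * k := by
          rw [Nat.choose_two_right, Nat.mul_div_cancel' (Nat.even_mul_pred_self _).two_dvd]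
          rfl
        zify at h1
        push_cast
        linarith
    rw [Nat.choose_succ_succ' n 2]
    push_cast
    linarith

theorem max_le_of_three_mul_add_three_le {s n : ℕ} (hs : 1 ≤ s) (hn : 3 * s + 3 ≤ n) :
    max ((3 * s - 1).choose 3) ((n - 1).choose 3 - (n - s).choose 3) + (n - 1).choose 2 ≤
      max ((3 * s + 2).choose 3) (n.choose 3 - (n - s).choose 3) := by
  have h1 : n.choose 3 = (n - 1).choose 2 + (n - 1).choose 3 := by
    obtain ⟨k, rfl⟩ : ∃ k, n = k + 1 := ⟨n - 1, by omega⟩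
    exact Nat.choose_succ_succ' k 2
  have h2 : (n - s).choose 3 ≤ (n - 1).choose 3 := Nat.choose_le_choose 3 (by omega)
  rw [max_add, max_le_iff]
  constructor
  swap
  · exact le_max_of_le_right (by omega)
  have e1 := six_mul_choose_three (3 * s - 1)
  have e2 := six_mul_choose_three (n - 1)
  have e3 := six_mul_choose_three (n - s)
  have e4 := six_mul_choose_three n
  have e5 := six_mul_choose_three (3 * s + 2)
  push_cast [Nat.cast_sub (by omega : 1 ≤ 3 * s), Nat.cast_sub (by omega : 1 ≤ n),
    Nat.cast_sub (by omega : s ≤ n)] at e1 e2 e3 e4 e5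
  rcases Nat.lt_or_ge (5 * s) n with h | h
  · refine le_max_of_le_right ?_
    suffices (3 * s - 1).choose 3 + (n - s).choose 3 ≤ (n - 1).choose 3 by omega
    obtain ⟨v, rfl⟩ : ∃ v, n = 5 * s + 1 + v := ⟨n - (5 * s + 1), by omega⟩
    obtain ⟨w, rfl⟩ : ∃ w, s = w + 1 := ⟨s - 1, by omega⟩
    zify
    push_cast at e1 e2 e3
    have hv : (0 : ℤ) ≤ v := Nat.cast_nonneg v
    have hw : (0 : ℤ) ≤ w := Nat.cast_nonneg w
    nlinarith [mul_nonneg hv hw, mul_nonneg hv hv, mul_nonneg hw hw,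
      mul_nonneg hv (mul_nonneg hv hw), mul_nonneg hv (mul_nonneg hw hw),
      mul_nonneg hw (mul_nonneg hw hw)]
  · refine le_max_of_le_left ?_
    zify at h1 h hn ⊢
    nlinarith

theorem le_max_choose_of_linkBound {s t c g m : ℕ} (hs : 1 ≤ s)
    (hg : 2 * g ≤ 5 * s * s + s) (hm : (s + 1) * g ≤ 2 * m)
    (hc : c + m ≤ (3 * s + 2).choose 3 + t * g) :
    c ≤ max ((3 * s + 2).choose 3) ((3 * s + 2 + t).choose 3 - (2 * s + 2 + t).choose 3) := by
  rcases Nat.lt_or_ge (s + 1) (2 * t) with h | h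
  swap
  · refine le_max_of_le_left ?_
    have := Nat.mul_le_mul_right g h
    linarith
  refine le_max_of_le_right ?_
  have e3 := six_mul_choose_three (2 * s + 2 + t)
  have e4 := six_mul_choose_three (3 * s + 2 + t)
  have e5 := six_mul_choose_three (3 * s + 2)
  refine Nat.le_sub_of_add_le ?_
  obtain ⟨w, rfl⟩ : ∃ w, s = w + 1 := ⟨s - 1, by omega⟩
  have hw : (0 : ℤ) ≤ w := Nat.cast_nonneg w
  have hu : (0 : ℤ) ≤ 2 * t - w - 2 := by omega
  zify at hg hm hc ⊢
  push_cast at e3 e4 e5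
  have h1 := mul_le_mul_of_nonneg_left hg hu
  nlinarith [mul_nonneg hw hu, mul_nonneg hw hw, mul_nonneg hu hu, mul_nonneg hw (mul_nonneg hw hw),
    mul_nonneg hw (mul_nonneg hw hu), mul_nonneg hw (mul_nonneg hu hu)]

theorem card_add_miss_le {F : Finset (Finset ℕ)} (hF : Shifted F) {s t : ℕ}
    (hFn : F ⊆ (Finset.Icc 1 (3 * s + 2 + t)).powersetCard 3)
    (h0 : ({3 * s + 3, 1, 3 * s + 2} : Finset ℕ) ∉ F) :
    F.card + (miss F (Finset.Icc 1 (3 * s + 2))).card ≤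
      (3 * s + 2).choose 3 + t * (topGraph F s).card := by
  set P := (Finset.Icc 1 (3 * s + 2)).powersetCard 3 with hP
  have h1 : (P.filter fun A => A ∈ F).card + (miss F (Finset.Icc 1 (3 * s + 2))).card =
      (3 * s + 2).choose 3 := by
    rw [miss, ← hP, Finset.card_filter_add_card_filter_not, hP, Finset.card_powersetCard,
      Nat.card_Icc, Nat.add_sub_cancel]
  have h2 : F ⊆ (P.filter fun A => A ∈ F) ∪ (Finset.Ioc (3 * s + 2) (3 * s + 2 + t)).biUnion
      fun x => (topGraph F s).image (insert x) := by
    intro A hA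
    obtain ⟨hAn, hAc⟩ := Finset.mem_powersetCard.1 (hFn hA)
    obtain ⟨x, y, z, hxy, hyz, rfl⟩ := exists_sorted_of_card_eq_three hAc
    have hx := Finset.mem_Icc.1 (hAn (by simp : x ∈ _))
    have hz := Finset.mem_Icc.1 (hAn (by simp : z ∈ _))
    rw [Finset.mem_union, Finset.mem_filter, hP, Finset.mem_powersetCard, Finset.mem_biUnion]
    by_cases hzs : z ≤ 3 * s + 2
    · refine Or.inl ⟨⟨fun w hw => ?_, hAc⟩, hA⟩
      simp only [Finset.mem_insert, Finset.mem_singleton] at hw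
      rw [Finset.mem_Icc]
      omega
    · refine Or.inr ⟨z, Finset.mem_Ioc.2 (by omega), Finset.mem_image.2 ⟨{x, y}, ?_, rfl⟩⟩
      have hy : y < 3 * s + 2 := by
        by_contra hy
        exact h0 (hF.triple le_rfl hxy hyz (by omega) (by omega) hx.1 (by omega) (by omega) hA)
      exact mem_topGraph.2 ⟨by omega,
        hF.triple hx.1 hxy hyz hxy (by omega) le_rfl le_rfl (by omega) hA⟩
  have h3 := (Finset.card_le_card h2).trans (Finset.card_union_le _ _)
  have h4 := Finset.card_biUnion_le_card_mul (Finset.Ioc (3 * s + 2) (3 * s + 2 + t))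
    (fun x => (topGraph F s).image (insert x)) _ fun x _ => Finset.card_image_le
  rw [Nat.card_Ioc, Nat.add_sub_cancel_left] at h4
  omega

theorem card_le_pullback_add {F : Finset (Finset ℕ)} {n : ℕ} (hn : 1 ≤ n)
    (hFn : F ⊆ (Finset.Icc 1 n).powersetCard 3) :
    F.card ≤ (pullback (addRightEmbedding 1) (n - 1) F).card + (n - 1).choose 2 := by
  have h : F ⊆ (pullback (addRightEmbedding 1) (n - 1) F).image
      (Finset.map (addRightEmbedding 1)) ∪ ((Finset.Icc 2 n).powersetCard 2).image (insert 1) := by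
    intro A hA
    obtain ⟨hAn, hAc⟩ := Finset.mem_powersetCard.1 (hFn hA)
    rw [Finset.mem_union, Finset.mem_image, Finset.mem_image]
    have herase : A.erase 1 ⊆ Finset.Icc 2 n := by
      intro x hx
      rw [Finset.mem_erase] at hx
      have := Finset.mem_Icc.1 (hAn hx.2)
      rw [Finset.mem_Icc]
      omega
    by_cases h1 : 1 ∈ A
    · refine Or.inr ⟨A.erase 1, Finset.mem_powersetCard.2 ⟨herase, ?_⟩, Finset.insert_erase h1⟩
      rw [Finset.card_erase_of_mem h1, hAc]
    · rw [Finset.erase_eq_of_notMem h1, show n = n - 1 + 1 by omega, ← map_add_one_Icc,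
        Finset.subset_map_iff] at herase
      obtain ⟨B, hB, rfl⟩ := herase
      rw [Finset.card_map] at hAc
      exact Or.inl ⟨B, mem_pullback.2 ⟨⟨hB, hAc⟩, hA⟩, rfl⟩
  refine (Finset.card_le_card h).trans ((Finset.card_union_le _ _).trans (add_le_add
    Finset.card_image_le (Finset.card_image_le.trans ?_)))
  rw [Finset.card_powersetCard, Nat.card_Icc, show n + 1 - 2 = n - 1 by omega]

theorem Shifted.card_le {s : ℕ} : ∀ {n : ℕ} {F : Finset (Finset ℕ)}, Shifted F → 3 * s + 2 ≤ n →
    F ⊆ (Finset.Icc 1 n).powersetCard 3 → ¬ HasMatching F (s + 1) →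
    F.card ≤ max ((3 * s + 2).choose 3) (n.choose 3 - (n - s).choose 3) := by
  induction s with
  | zero =>
    intro n F _ _ _ hM
    have : F = ∅ := Finset.eq_empty_of_forall_notMem fun A hA => hM (hasMatching_one hA)
    simp [this]
  | succ r ih =>
    intro n F hF hn hFn hM
    obtain ⟨s, hs⟩ : ∃ s, s = r + 1 := ⟨_, rfl⟩
    rw [← hs] at hM hn ⊢
    obtain ⟨t, rfl⟩ := Nat.exists_eq_add_of_le hn
    by_cases h0 : ({3 * s + 3, 1, 3 * s + 2} : Finset ℕ) ∈ F
    · have hn3 : 3 * s + 3 ≤ 3 * s + 2 + t :=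
        (Finset.mem_Icc.1 ((Finset.mem_powersetCard.1 (hFn h0)).1 (by simp))).2
      refine le_trans ?_ (max_le_of_three_mul_add_three_le (by omega) hn3)
      refine (card_le_pullback_add (by omega) hFn).trans (Nat.add_le_add_right ?_ _)
      have h := ih (n := 3 * s + 2 + t - 1) (hF.pullback (φ := addRightEmbedding 1)
        (fun x y h => by simpa using h) (by simp) (3 * s + 2 + t - 1)) (by omega)
        (Finset.filter_subset _ _) (fun hM' => ?_)
      · rwa [show 3 * s - 1 = 3 * r + 2 by omega,
          show 3 * s + 2 + t - s = 3 * s + 2 + t - 1 - r by omega]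
      · obtain ⟨f, hf, hd⟩ := (hF.pullback (φ := addRightEmbedding 1)
          (fun x y h => by simpa using h) (by simp) (3 * s + 2 + t - 1)).hasMatching_initial
          (Finset.filter_subset _ _) hM'
        simp only [Finset.mem_filter, mem_pullback] at hf
        refine hM (HasMatching.of_option (fun i => (f i).map (addRightEmbedding 1))
          (fun i => (hf i).1.2) (fun i j hij => (Finset.disjoint_map _).2 (hd hij)) h0
          (fun i => ?_) (by simp; omega))
        refine Finset.disjoint_left.2 fun x hx hx' => ?_
        obtain ⟨y, hy, rfl⟩ := Finset.mem_map.1 hx'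
        have := Finset.mem_Icc.1 ((hf i).2 hy)
        simp only [Finset.mem_insert, Finset.mem_singleton, addRightEmbedding_apply] at hx
        omega
    · rw [show 3 * s + 2 + t - s = 2 * s + 2 + t by omega]
      exact le_max_choose_of_linkBound (by omega) (two_mul_card_topGraph_le hF hM h0)
        (linkBound (by omega) F hF hM) (card_add_miss_le hF hFn h0)

theorem map_swap_insert {x y : ℕ} {A : Finset ℕ} (hx : x ∉ A) (hy : y ∉ A) :
    (insert x A).map (Equiv.swap x y).toEmbedding = insert y A := by
  rw [Finset.map_insert, Equiv.coe_toEmbedding, Equiv.swap_apply_left]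
  congr 1
  ext z
  rw [Finset.mem_map_equiv, Equiv.symm_swap]
  by_cases h1 : z = x
  · subst h1; simp [hx, hy]
  by_cases h2 : z = y
  · subst h2; simp [hx, hy]
  rw [Equiv.swap_apply_of_ne_of_ne h1 h2]

/-- The effect of the `(x, y)`-shift of the family `F` on its member `A`. -/
def shiftMem (F : Finset (Finset ℕ)) (x y : ℕ) (A : Finset ℕ) : Finset ℕ :=
  if x ∈ A ∧ y ∉ A ∧ A.map (Equiv.swap x y).toEmbedding ∉ F then
    A.map (Equiv.swap x y).toEmbedding else A

section shiftMem

variable {F : Finset (Finset ℕ)} {x y : ℕ} {A : Finset ℕ}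

theorem shiftMem_cases (F : Finset (Finset ℕ)) (x y : ℕ) (A : Finset ℕ) :
    (∃ B, x ∉ B ∧ y ∉ B ∧ A = insert x B ∧ insert y B ∉ F ∧ shiftMem F x y A = insert y B) ∨
      shiftMem F x y A = A ∧ ∀ B, x ∉ B → y ∉ B → y ≠ x → A = insert x B →
        insert y B ∈ F := by
  by_cases h : x ∈ A ∧ y ∉ A ∧ A.map (Equiv.swap x y).toEmbedding ∉ F
  · have h1 : y ∉ A.erase x := fun h' => h.2.1 (Finset.mem_of_mem_erase h')
    have h2 := map_swap_insert (Finset.notMem_erase x A) h1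
    rw [Finset.insert_erase h.1] at h2
    refine Or.inl ⟨A.erase x, by simp, h1, (Finset.insert_erase h.1).symm, h2 ▸ h.2.2, ?_⟩
    rw [shiftMem, if_pos h, h2]
  · refine Or.inr ⟨if_neg h, ?_⟩
    rintro B hx hy hxy rfl
    by_contra hB
    rw [map_swap_insert hx hy] at h
    exact h ⟨by simp, by simp [hy, hxy], hB⟩

theorem card_shiftMem (hA : A.card = 3) : (shiftMem F x y A).card = 3 := by
  rw [shiftMem]
  split_ifs
  · rwa [Finset.card_map]
  · exact hA

theorem shiftMem_injOn : Set.InjOn (shiftMem F x y) F := by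
  intro A hA B hB h
  rcases shiftMem_cases F x y A with ⟨A', h1, h2, rfl, h4, h5⟩ | ⟨h1, -⟩ <;>
    rcases shiftMem_cases F x y B with ⟨B', k1, k2, rfl, k4, k5⟩ | ⟨k1, -⟩
  · rw [h5, k5] at h
    rw [← Finset.erase_insert h2, h, Finset.erase_insert k2]
  · rw [h5, k1] at h
    exact absurd hB (h ▸ h4)
  · rw [h1, k5] at h
    exact absurd hA (h ▸ k4)
  · rwa [h1, k1] at h

theorem HasMatching.of_shift {p : ℕ} (h : HasMatching (F.image (shiftMem F x y)) p) :
    HasMatching F p := by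
  obtain ⟨g, hg, hd⟩ := h
  by_cases hF : ∀ i, g i ∈ F
  · exact ⟨g, hF, hd⟩
  have key : ∀ i, g i ∉ F → ∃ B, x ∉ B ∧ y ∉ B ∧ insert x B ∈ F ∧ g i = insert y B := by
    intro i hi
    obtain ⟨A, hA, hAi⟩ := Finset.mem_image.1 (hg i)
    rcases shiftMem_cases F x y A with ⟨B, h1, h2, rfl, -, h5⟩ | ⟨h1, -⟩
    · exact ⟨B, h1, h2, hA, by rw [← hAi, h5]⟩
    · rw [h1] at hAi
      exact absurd (hAi ▸ hA) hi
  push Not at hF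
  obtain ⟨i₀, hi₀⟩ := hF
  obtain ⟨B, hxB, hyB, hB, hgB⟩ := key i₀ hi₀
  refine ⟨fun i => (g i).map (Equiv.swap x y).toEmbedding, fun i => ?_,
    fun i j hij => (Finset.disjoint_map _).2 (hd hij)⟩
  show (g i).map (Equiv.swap x y).toEmbedding ∈ F
  by_cases hi : i = i₀
  · rwa [hi, hgB, Equiv.swap_comm, map_swap_insert hyB hxB]
  have hy : y ∉ g i := fun h => Finset.disjoint_left.1 (hd hi) h (by simp [hgB])
  have hiF : g i ∈ F := by
    by_contra h
    obtain ⟨C, -, -, -, hC⟩ := key i h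
    exact hy (by simp [hC])
  by_cases hx : x ∈ g i
  · obtain ⟨A, hA, hAi⟩ := Finset.mem_image.1 (hg i)
    have hy' : y ∉ (g i).erase x := fun h => hy (Finset.mem_of_mem_erase h)
    rcases shiftMem_cases F x y A with ⟨C, h1, h2, rfl, -, h5⟩ | ⟨h1, h2⟩
    · exact absurd (by rw [← hAi, h5]; simp) hy
    · rw [h1] at hAi
      have := h2 _ (Finset.notMem_erase x _) hy' (fun h => hy (h ▸ hx)) (by rw [hAi, Finset.insert_erase hx])
      rwa [← Finset.insert_erase hx, map_swap_insert (Finset.notMem_erase x _) hy']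
  · have : (g i).map (Equiv.swap x y).toEmbedding = g i := by
      ext z
      rw [Finset.mem_map_equiv, Equiv.symm_swap]
      by_cases h1 : z = x
      · simp [h1, hx, hy]
      by_cases h2 : z = y
      · simp [h2, hx, hy]
      rw [Equiv.swap_apply_of_ne_of_ne h1 h2]
    rwa [this]

end shiftMem

theorem exists_shifted {n p : ℕ} {F : Finset (Finset ℕ)}
    (hF : F ⊆ (Finset.Icc 1 n).powersetCard 3) (hM : ¬ HasMatching F p) :
    ∃ G ⊆ (Finset.Icc 1 n).powersetCard 3, Shifted G ∧ ¬ HasMatching G p ∧ G.card = F.card := by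
  induction hw : ∑ A ∈ F, ∑ z ∈ A, z using Nat.strong_induction_on generalizing F with
  | _ w ih =>
    by_cases hS : Shifted F
    · exact ⟨F, hF, hS, hM, rfl⟩
    rw [Shifted] at hS
    push Not at hS
    obtain ⟨A, x, y, hx, hy, hy1, hyx, hxA, hyA⟩ := hS
    have hlt : y < x := lt_of_le_of_ne hyx fun h => hyA (h ▸ hxA)
    have hle : ∀ B, ∑ z ∈ shiftMem F x y B, z ≤ ∑ z ∈ B, z := by
      intro B
      rcases shiftMem_cases F x y B with ⟨C, h1, h2, rfl, -, h5⟩ | ⟨h1, -⟩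
      · rw [h5, Finset.sum_insert h2, Finset.sum_insert h1]
        omega
      · rw [h1]
    obtain ⟨G, hG, hGS, hGM, hGc⟩ := ih (∑ B ∈ F.image (shiftMem F x y), ∑ z ∈ B, z)
      (by
        rw [← hw, Finset.sum_image shiftMem_injOn]
        refine Finset.sum_lt_sum (fun B _ => hle B) ⟨_, hxA, ?_⟩
        rcases shiftMem_cases F x y (insert x A) with ⟨C, h1, h2, h3, -, h5⟩ | ⟨-, h2⟩
        · rw [h5, h3, Finset.sum_insert h2, Finset.sum_insert h1]
          omega
        · exact absurd (h2 A hx hy hlt.ne rfl) hyA)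
      (F := F.image (shiftMem F x y))
      (by
        intro B hB
        obtain ⟨C, hC, rfl⟩ := Finset.mem_image.1 hB
        obtain ⟨h1, h2⟩ := Finset.mem_powersetCard.1 (hF hC)
        refine Finset.mem_powersetCard.2 ⟨?_, card_shiftMem h2⟩
        rcases shiftMem_cases F x y C with ⟨D, -, -, rfl, -, h5⟩ | ⟨h5, -⟩
        · rw [h5]
          rw [Finset.insert_subset_iff, Finset.mem_Icc] at h1 ⊢
          exact ⟨by omega, h1.2⟩
        · rwa [h5])
      (fun h => hM h.of_shift) rfl
    exact ⟨G, hG, hGS, hGM, hGc.trans (Finset.card_image_of_injOn shiftMem_injOn)⟩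

theorem not_hasMatching_of_matchNum_lt {F : Finset (Finset ℕ)} (hF : ∀ A ∈ F, A.Nonempty) {p : ℕ}
    (hp : matchNum F < p) : ¬ HasMatching F p := by
  rintro ⟨f, hf, hd⟩
  have hinj : Function.Injective f := by
    intro i j hij
    by_contra h
    have := hd h
    simp only [hij, disjoint_self] at this
    exact (hF _ (hf j)).ne_empty this
  refine hp.not_ge (le_csSup ⟨F.card, ?_⟩ ⟨Finset.univ.image f, ?_, ?_, ?_, ?_⟩)
  · rintro m ⟨M, hM, rfl, -⟩
    exact Finset.card_le_card hM
  · intro A hA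
    obtain ⟨i, -, rfl⟩ := Finset.mem_image.1 hA
    exact hf i
  · rw [Finset.card_image_of_injective _ hinj, Finset.card_univ, Fintype.card_fin]
  · intro A hA
    obtain ⟨i, -, rfl⟩ := Finset.mem_image.1 hA
    exact hF _ (hf i)
  · intro A hA B hB hAB
    obtain ⟨i, -, rfl⟩ := Finset.mem_image.1 (Finset.mem_coe.1 hA)
    obtain ⟨j, -, rfl⟩ := Finset.mem_image.1 (Finset.mem_coe.1 hB)
    exact hd fun h => hAB (h ▸ rfl)

/-- Erdős Matching Conjecture for `k = 3`: for `s ≥ 1` and `n ≥ 3s+2`, every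
family of 3-element subsets of `[n]` with matching number `s` has at most
`max { C(3s+2,3), C(n,3) − C(n−s,3) }` members. -/
theorem erdos_matching_three (s n : ℕ) (hs : 1 ≤ s) (hn : 3 * s + 2 ≤ n)
    (𝓕 : Finset (Finset ℕ)) (h𝓕 : 𝓕 ⊆ Finset.powersetCard 3 (Finset.Icc 1 n))
    (hν : matchNum 𝓕 = s) :
    𝓕.card ≤ max ((3 * s + 2).choose 3) (n.choose 3 - (n - s).choose 3) := by
  obtain ⟨G, hG, hGS, hGM, hGc⟩ := exists_shifted h𝓕 (not_hasMatching_of_matchNum_lt (p := s + 1)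
    (fun A hA => Finset.card_pos.1 (by rw [(Finset.mem_powersetCard.1 (h𝓕 hA)).2]; norm_num))
    (by omega))
  rw [← hGc]
  exact hGS.card_le hn hG hGM
end

section
/- Let k ≥ 1, s ≥ 1 and n ≥ ks+k−1, and let 𝓕 be a stable family of k-element subsets of [n] with ν(𝓕) = s. Then the trace family 𝓕₀ = { F ∩ [ks+k−1] : F ∈ 𝓕 } contains no s+1 pairwise disjoint members, and it contains s pairwise disjoint nonempty members; that is, ν(𝓕₀) = s. -/
theorem bddAbove_matchNum (𝓕 : Finset (Finset ℕ)) :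
    BddAbove {m | ∃ M ⊆ 𝓕, M.card = m ∧ (∀ A ∈ M, A.Nonempty) ∧
      (M : Set (Finset ℕ)).Pairwise fun A B => Disjoint A B} := by
  refine ⟨𝓕.card, ?_⟩
  rintro m ⟨M, hM, rfl, -⟩
  exact Finset.card_le_card hM

theorem exists_card_eq_matchNum (𝓕 : Finset (Finset ℕ)) :
    ∃ M ⊆ 𝓕, M.card = matchNum 𝓕 ∧ (∀ A ∈ M, A.Nonempty) ∧
      (M : Set (Finset ℕ)).Pairwise fun A B => Disjoint A B :=
  Nat.sSup_mem ⟨0, by exact ⟨∅, by simp⟩⟩ (bddAbove_matchNum 𝓕)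

theorem card_le_matchNum {ι : Type*} [Fintype ι] {𝓕 : Finset (Finset ℕ)} {A : ι → Finset ℕ}
    (hA : ∀ i, A i ∈ 𝓕) (hne : ∀ i, (A i).Nonempty)
    (hd : Pairwise fun i j => Disjoint (A i) (A j)) :
    Fintype.card ι ≤ matchNum 𝓕 := by
  have hinj : Function.Injective A := by
    intro i j hij
    by_contra h
    have h1 : Disjoint (A i) (A j) := hd h
    rw [hij, disjoint_self] at h1
    exact (hne j).ne_empty h1
  refine le_csSup (bddAbove_matchNum 𝓕) ⟨Finset.univ.image A, ?_, ?_, ?_, ?_⟩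
  · simpa [Finset.subset_iff] using hA
  · rw [Finset.card_image_of_injective _ hinj, Finset.card_univ]
  · simpa using hne
  · intro B hB C hC hBC
    simp only [Finset.coe_image, Finset.coe_univ, Set.image_univ, Set.mem_range] at hB hC
    obtain ⟨i, rfl⟩ := hB
    obtain ⟨j, rfl⟩ := hC
    exact hd fun h => hBC (congrArg A h)

/-- Elements of the `F i` beyond `N` can be pushed down into unused places of `[N]`, all but one
of them, so that the `F i` become disjoint as soon as their traces on `[N]` are. -/
theorem card_le_matchNum_of_disjoint_traces {ι : Type*} [Fintype ι] {k n N : ℕ} (hk : 1 ≤ k)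
    (hcard : k * Fintype.card ι = N + 1) {𝓕 : Finset (Finset ℕ)}
    (h𝓕 : 𝓕 ⊆ Finset.powersetCard k (Finset.Icc 1 n)) (hst : Stable n 𝓕)
    {F : ι → Finset ℕ} (hF : ∀ i, F i ∈ 𝓕)
    (hd : Pairwise fun i j => Disjoint (F i ∩ Finset.Icc 1 N) (F j ∩ Finset.Icc 1 N)) :
    Fintype.card ι ≤ matchNum 𝓕 := by
  classical
  have hFk : ∀ i, F i ⊆ Finset.Icc 1 n ∧ (F i).card = k := fun i =>
    Finset.mem_powersetCard.1 (h𝓕 (hF i))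
  let α := Σ i, F i
  let v : α → ℕ := fun p => p.2
  have hv : ∀ p, 1 ≤ v p ∧ v p ≤ n := fun p => Finset.mem_Icc.1 ((hFk p.1).1 p.2.2)
  have hα : Fintype.card α = N + 1 := by
    simp [α, Fintype.card_sigma, hFk, ← hcard, mul_comm]
  have hvinj : ∀ p q, v p ≤ N → v p = v q → p = q := by
    rintro ⟨i, x, hx⟩ ⟨j, y, hy⟩ hp hpq
    have hx1 := hv ⟨i, x, hx⟩
    simp only [v] at hp hpq hx1
    subst hpq
    obtain rfl : i = j := by
      by_contra h
      have hxN := Finset.mem_Icc.2 ⟨hx1.1, hp⟩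
      exact Finset.disjoint_left.1 (hd h) (Finset.mem_inter.2 ⟨hx, hxN⟩)
        (Finset.mem_inter.2 ⟨hy, hxN⟩)
    rfl
  obtain ⟨d, hdN⟩ : ∃ d, N < v d := by
    by_contra! h
    have h1 := Finset.card_le_card_of_injOn (s := Finset.univ) (t := Finset.Icc 1 N) v
      (fun p _ => by simpa using ⟨(hv p).1, h p⟩) (fun p _ q _ hpq => hvinj p q (h p) hpq)
    rw [Finset.card_univ, hα, Nat.card_Icc] at h1
    omega
  let t := insert (v d) (Finset.Icc 1 N)
  have ht : Fintype.card α = t.card := by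
    rw [hα, Finset.card_insert_of_notMem (by simp; omega), Nat.card_Icc]
    omega
  let u : Finset α := Finset.univ.filter fun p => v p ≤ N ∨ p = d
  have hut : u.image v ⊆ t := by
    intro x hx
    obtain ⟨p, hp, rfl⟩ := Finset.mem_image.1 hx
    rcases (Finset.mem_filter.1 hp).2 with h | rfl
    · simp [t, h, (hv p).1]
    · simp [t]
  have hui : Set.InjOn v u := by
    intro p hp q hq hpq
    rcases (Finset.mem_filter.1 hp).2 with h | rfl
    · exact hvinj p q h hpq
    · rcases (Finset.mem_filter.1 hq).2 with h | rfl
      · omega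
      · rfl
  obtain ⟨g, hg⟩ := Finset.exists_equiv_extend_of_card_eq ht hut hui
  have hgi : ∀ p q, (g p : ℕ) = g q → p = q := fun p q h => g.injective (Subtype.ext h)
  have hgle : ∀ p, 1 ≤ (g p : ℕ) ∧ (g p : ℕ) ≤ v p := by
    intro p
    by_cases hp : p ∈ u
    · rw [hg p hp]
      exact ⟨(hv p).1, le_rfl⟩
    · have hp' : N < v p ∧ p ≠ d := by simpa [u] using hp
      rcases Finset.mem_insert.1 (g p).2 with h | h
      · exact absurd (hgi p d (by rw [h, hg d (by simp [u])])) hp'.2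
      · rw [Finset.mem_Icc] at h
        omega
  have hinj : ∀ i, Function.Injective fun x : F i => (g ⟨i, x⟩ : ℕ) := by
    intro i x y hxy
    exact eq_of_heq (Sigma.mk.inj (hgi _ _ hxy)).2
  let G : ι → Finset ℕ := fun i => Finset.univ.image fun x : F i => (g ⟨i, x⟩ : ℕ)
  have hGcard : ∀ i, (G i).card = (F i).card := fun i => by
    rw [Finset.card_image_of_injective _ (hinj i), Finset.card_univ, Fintype.card_coe]
  refine card_le_matchNum (A := G) ?_ ?_ ?_
  · intro i
    refine hst (F i) (hF i) (G i) ?_ (hGcard i)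
      ⟨fun x => if hx : x ∈ F i then g ⟨i, x, hx⟩ else 0, ⟨?_, ?_, ?_⟩, ?_⟩
    · intro y hy
      obtain ⟨x, -, rfl⟩ := Finset.mem_image.1 hy
      exact Finset.mem_Icc.2 ⟨(hgle _).1, (hgle _).2.trans (hv _).2⟩
    · intro x hx
      rw [Finset.mem_coe] at hx
      simp only [hx, dite_true]
      exact Finset.mem_image_of_mem (fun x : F i => (g ⟨i, x⟩ : ℕ)) 
        (Finset.mem_univ (⟨x, hx⟩ : F i))
    · intro x hx y hy hxy
      rw [Finset.mem_coe] at hx hy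
      simp only [hx, hy, dite_true] at hxy
      exact congrArg Subtype.val (hinj i hxy)
    · intro y hy
      obtain ⟨x, -, rfl⟩ := Finset.mem_image.1 hy
      exact ⟨x, x.2, by simp⟩
    · intro x hx
      simp only [hx, dite_true]
      exact (hgle _).2
  · intro i
    rw [← Finset.card_pos, hGcard, (hFk i).2]
    exact hk
  · intro i j hij
    refine Finset.disjoint_left.2 fun y hy hy' => ?_
    obtain ⟨x, -, rfl⟩ := Finset.mem_image.1 hy
    obtain ⟨z, -, hz⟩ := Finset.mem_image.1 hy'
    exact hij (congrArg Sigma.fst (hgi _ _ hz)).symm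

/-- For a stable family `𝓕` of `k`-subsets of `[n]` with `ν(𝓕) = s`, the trace
family `𝓕₀ = { F ∩ [ks+k−1] : F ∈ 𝓕 }` also has matching number `s` (counting
pairwise disjoint nonempty members). -/
theorem trace_matching_number (k s n : ℕ) (hk : 1 ≤ k) (hs : 1 ≤ s)
    (hn : k * s + k - 1 ≤ n)
    (𝓕 : Finset (Finset ℕ)) (h𝓕 : 𝓕 ⊆ Finset.powersetCard k (Finset.Icc 1 n))
    (hst : Stable n 𝓕) (hν : matchNum 𝓕 = s) :
    matchNum (𝓕.image fun F => F ∩ Finset.Icc 1 (k * s + k - 1)) = s := by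
  have hcore : ∀ {ι : Type} [Fintype ι], Fintype.card ι = s + 1 → ∀ F : ι → Finset ℕ,
      (∀ i, F i ∈ 𝓕) → ¬ Pairwise fun i j =>
        Disjoint (F i ∩ Finset.Icc 1 (k * s + k - 1)) (F j ∩ Finset.Icc 1 (k * s + k - 1)) := by
    intro ι _ hι F hF hd
    have h := card_le_matchNum_of_disjoint_traces hk
      (by rw [hι, mul_add, mul_one]; omega) h𝓕 hst hF hd
    omega
  apply le_antisymm
  · by_contra! h
    obtain ⟨M, hM, hMc, -, hMd⟩ :=
      exists_card_eq_matchNum (𝓕.image fun F => F ∩ Finset.Icc 1 (k * s + k - 1))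
    obtain ⟨M', hM', hc⟩ := Finset.exists_subset_card_eq (show s + 1 ≤ M.card by omega)
    have hex : ∀ T : M', ∃ F ∈ 𝓕, F ∩ Finset.Icc 1 (k * s + k - 1) = T := fun T =>
      Finset.mem_image.1 (hM (hM' T.2))
    choose F hF hFT using hex
    refine hcore (by rw [Fintype.card_coe, hc]) F hF fun T U hTU => ?_
    simp only [hFT]
    exact hMd (hM' T.2) (hM' U.2) fun h => hTU (Subtype.ext h)
  · obtain ⟨M, hM, hMc, -, hMd⟩ := exists_card_eq_matchNum 𝓕
    refine (show s = Fintype.card M by rw [Fintype.card_coe, hMc, hν]).le.trans ?_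
    refine card_le_matchNum (A := fun F : M => (F : Finset ℕ) ∩ Finset.Icc 1 (k * s + k - 1))
      (fun F => Finset.mem_image.2 ⟨F, hM F.2, rfl⟩) (fun F => ?_) fun F G hFG => ?_
    · by_contra hempty
      rw [Finset.not_nonempty_iff_eq_empty] at hempty
      refine hcore (Fintype.card_fin (s + 1)) (fun _ => F) (fun _ => hM F.2) fun i j _ => ?_
      simp [hempty]
    · exact (hMd F.2 G.2 fun h => hFG (Subtype.ext h)).mono Finset.inter_subset_left
        Finset.inter_subset_left
end

section
/- Let k ≥ 1, s ≥ 1, 1 ≤ ℓ ≤ k and n ≥ ks. Then the family 𝓐_ℓ(n) = { F : F a k-element subset of [n] with |F ∩ [ℓs+ℓ−1]| ≥ ℓ } has matching number exactly s, i.e. ν(𝓐_ℓ(n)) = s. -/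
/-- The first `k` positive integers congruent to `i + 1` modulo `s`. -/
def residueBlock (s k i : ℕ) : Finset ℕ := (Finset.range k).image fun j => i + 1 + s * j

theorem residueBlock_step_injective {s : ℕ} (hs : 1 ≤ s) (i : ℕ) :
    Function.Injective fun j => i + 1 + s * j := by
  intro a b hab
  exact Nat.eq_of_mul_eq_mul_left hs (Nat.add_left_cancel hab)

theorem card_residueBlock {s : ℕ} (hs : 1 ≤ s) (k i : ℕ) : (residueBlock s k i).card = k := by
  rw [residueBlock, Finset.card_image_of_injective _ (residueBlock_step_injective hs i),
    Finset.card_range]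

theorem residueBlock_mono (s i : ℕ) {ℓ k : ℕ} (h : ℓ ≤ k) :
    residueBlock s ℓ i ⊆ residueBlock s k i :=
  Finset.image_subset_image (Finset.range_mono h)

theorem residueBlock_subset_Icc {s k i : ℕ} (hi : i < s) :
    residueBlock s k i ⊆ Finset.Icc 1 (k * s) := by
  intro x hx
  obtain ⟨j, hj, rfl⟩ := Finset.mem_image.1 hx
  have hjk : j + 1 ≤ k := Finset.mem_range.1 hj
  rw [Finset.mem_Icc]
  constructor
  · omega
  · calc i + 1 + s * j ≤ s + s * j := by omega
      _ = (j + 1) * s := by ring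
      _ ≤ k * s := Nat.mul_le_mul_right s hjk

theorem eq_of_mem_residueBlock {s k i i' x : ℕ} (hi : i < s) (hi' : i' < s)
    (hx : x ∈ residueBlock s k i) (hx' : x ∈ residueBlock s k i') : i = i' := by
  obtain ⟨a, -, rfl⟩ := Finset.mem_image.1 hx
  obtain ⟨b, -, hb⟩ := Finset.mem_image.1 hx'
  have h : (i' + s * b) % s = (i + s * a) % s := congrArg (· % s) (by omega)
  rw [Nat.add_mul_mod_self_left, Nat.add_mul_mod_self_left, Nat.mod_eq_of_lt hi,
    Nat.mod_eq_of_lt hi'] at h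
  exact h.symm

/-- Pairwise disjoint sets that each meet `T` in at least `ℓ` points number at most
`T.card / ℓ`. -/
theorem card_mul_le_of_pairwise_disjoint {α : Type*} [DecidableEq α] {M : Finset (Finset α)}
    {T : Finset α} {ℓ : ℕ} (hM : (M : Set (Finset α)).Pairwise fun A B => Disjoint A B)
    (hT : ∀ A ∈ M, ℓ ≤ (A ∩ T).card) : M.card * ℓ ≤ T.card := by
  calc M.card * ℓ ≤ ∑ A ∈ M, (A ∩ T).card := by
        simpa using Finset.card_nsmul_le_sum M (fun A => (A ∩ T).card) ℓ hT
    _ = (M.biUnion fun A => A ∩ T).card :=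
        (Finset.card_biUnion fun A hA B hB hAB => (hM hA hB hAB).mono
          Finset.inter_subset_left Finset.inter_subset_left).symm
    _ ≤ T.card := Finset.card_le_card
        (Finset.biUnion_subset.2 fun _ _ => Finset.inter_subset_right)

/-- For `1 ≤ ℓ ≤ k` and `n ≥ ks`, the family
`𝓐_ℓ(n) = { F ∈ ([n] choose k) : |F ∩ [ℓs+ℓ−1]| ≥ ℓ }` has matching
number exactly `s`. -/
theorem matching_number_A_ell (k s ℓ n : ℕ) (hk : 1 ≤ k) (hs : 1 ≤ s)
    (hl1 : 1 ≤ ℓ) (hlk : ℓ ≤ k) (hn : k * s ≤ n) :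
    matchNum ((Finset.powersetCard k (Finset.Icc 1 n)).filter
      fun F => ℓ ≤ (F ∩ Finset.Icc 1 (ℓ * s + ℓ - 1)).card) = s := by
  refine IsGreatest.csSup_eq ⟨⟨(Finset.range s).image (residueBlock s k), ?_, ?_, ?_, ?_⟩, ?_⟩
  · intro F hF
    obtain ⟨i, hi, rfl⟩ := Finset.mem_image.1 hF
    have his : i < s := Finset.mem_range.1 hi
    refine Finset.mem_filter.2 ⟨Finset.mem_powersetCard.2
      ⟨(residueBlock_subset_Icc his).trans (Finset.Icc_subset_Icc_right hn),
        card_residueBlock hs k i⟩, ?_⟩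
    calc ℓ = (residueBlock s ℓ i).card := (card_residueBlock hs ℓ i).symm
      _ ≤ _ := Finset.card_le_card (Finset.subset_inter (residueBlock_mono s i hlk)
        ((residueBlock_subset_Icc his).trans (Finset.Icc_subset_Icc_right (by omega))))
  · rw [Finset.card_image_of_injOn, Finset.card_range]
    intro i hi i' hi' h
    obtain ⟨x, hx⟩ : (residueBlock s k i).Nonempty :=
      Finset.card_pos.1 (by rw [card_residueBlock hs]; exact hk)
    exact eq_of_mem_residueBlock (Finset.mem_range.1 hi) (Finset.mem_range.1 hi') hx (h ▸ hx)
  · intro A hA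
    obtain ⟨i, -, rfl⟩ := Finset.mem_image.1 hA
    exact Finset.card_pos.1 (by rw [card_residueBlock hs]; exact hk)
  · intro A hA B hB hAB
    obtain ⟨i, hi, rfl⟩ := Finset.mem_image.1 hA
    obtain ⟨i', hi', rfl⟩ := Finset.mem_image.1 hB
    refine Finset.disjoint_left.2 fun x hx hx' => hAB ?_
    rw [eq_of_mem_residueBlock (Finset.mem_range.1 hi) (Finset.mem_range.1 hi') hx hx']
  · rintro m ⟨M, hM, rfl, -, hdisj⟩
    have h := card_mul_le_of_pairwise_disjoint hdisj fun A hA => (Finset.mem_filter.1 (hM hA)).2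
    rw [Nat.card_Icc, Nat.add_sub_cancel] at h
    refine Nat.lt_succ_iff.1 (lt_of_mul_lt_mul_right (a := ℓ) ?_ (Nat.zero_le ℓ))
    calc M.card * ℓ < ℓ * s + ℓ := by omega
      _ = s.succ * ℓ := by rw [Nat.succ_mul, Nat.mul_comm]
end

section
/- Let k = 3, s ≥ 1, n ≥ 3s+2 and 1 ≤ ℓ ≤ 3. Then |𝓐_ℓ(n)| ≤ max{ C(n,3) − C(n−s,3), C(3s+2,3) }, where 𝓐_ℓ(n) = { F : F a 3-element subset of [n] with |F ∩ [ℓs+ℓ−1]| ≥ ℓ }. -/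
theorem Nat.six_mul_choose_three (a : ℕ) : 6 * (a + 2).choose 3 = (a + 2) * (a + 1) * a := by
  have h := Nat.descFactorial_eq_factorial_mul_choose (a + 2) 3
  simp only [Nat.descFactorial_succ, Nat.descFactorial_zero, Nat.factorial] at h
  have e : a + 2 - 2 = a := by omega
  have e' : a + 2 - 1 = a + 1 := by omega
  rw [e, e'] at h
  norm_num at h
  linarith

theorem Nat.two_mul_choose_two (a : ℕ) : 2 * (a + 1).choose 2 = (a + 1) * a := by
  have h := Nat.descFactorial_eq_factorial_mul_choose (a + 1) 2
  simp only [Nat.descFactorial_succ, Nat.descFactorial_zero, Nat.factorial] at h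
  have e : a + 1 - 1 = a := by omega
  rw [e] at h
  norm_num at h
  linarith

/-- The `3`-subsets of `[n]` that meet `[m]` are those not contained in `[n] \ [m]`. -/
theorem card_filter_one_le_card_inter (m n : ℕ) :
    ((Finset.powersetCard 3 (Finset.Icc 1 n)).filter
      fun F => 1 ≤ (F ∩ Finset.Icc 1 m).card).card = n.choose 3 - (n - m).choose 3 := by
  have h : ((Finset.powersetCard 3 (Finset.Icc 1 n)).filter
      fun F => 1 ≤ (F ∩ Finset.Icc 1 m).card) =
      Finset.powersetCard 3 (Finset.Icc 1 n) \ Finset.powersetCard 3 (Finset.Icc (m + 1) n) := by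
    ext F
    simp only [Finset.mem_filter, Finset.mem_sdiff, Finset.mem_powersetCard, not_and,
      Nat.one_le_iff_ne_zero, Finset.card_ne_zero, Finset.Nonempty, Finset.mem_inter,
      Finset.mem_Icc]
    refine and_congr_right fun ⟨hF, hc⟩ => ⟨?_, fun h => ?_⟩
    · rintro ⟨x, hx, hx'⟩ hs
      have := Finset.mem_Icc.1 (hs hx)
      omega
    · by_contra! hne
      refine h (fun x hx => ?_) hc
      have h₁ := Finset.mem_Icc.1 (hF hx)
      have h₂ := hne x hx (by omega)
      rw [Finset.mem_Icc]
      omega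
  rw [h, Finset.card_sdiff_of_subset (Finset.powersetCard_mono
    (Finset.Icc_subset_Icc_left (by omega))), Finset.card_powersetCard, Finset.card_powersetCard,
    Nat.card_Icc, Nat.card_Icc]
  congr 2
  omega

/-- A `3`-set with at least two elements in `[m]` is contained in `[m]` or is a pair in `[m]`
together with an element outside `[m]`. -/
theorem card_filter_two_le_card_inter_le (m n : ℕ) :
    ((Finset.powersetCard 3 (Finset.Icc 1 n)).filter
      fun F => 2 ≤ (F ∩ Finset.Icc 1 m).card).card ≤ m.choose 3 + m.choose 2 * (n - m) := by
  have h : ((Finset.powersetCard 3 (Finset.Icc 1 n)).filter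
      fun F => 2 ≤ (F ∩ Finset.Icc 1 m).card) ⊆
      Finset.powersetCard 3 (Finset.Icc 1 m) ∪
        (Finset.powersetCard 2 (Finset.Icc 1 m) ×ˢ Finset.Icc (m + 1) n).image
          fun p => insert p.2 p.1 := by
    intro F hF
    simp only [Finset.mem_filter, Finset.mem_powersetCard] at hF
    obtain ⟨⟨hF, hc⟩, h2⟩ := hF
    rw [Finset.mem_union]
    by_cases hs : F ⊆ Finset.Icc 1 m
    · exact Or.inl (Finset.mem_powersetCard.2 ⟨hs, hc⟩)
    · right
      obtain ⟨x, hx, hxm⟩ := Finset.not_subset.1 hs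
      have hsub : F ∩ Finset.Icc 1 m ⊆ F.erase x := fun y hy => by
        rw [Finset.mem_inter] at hy
        exact Finset.mem_erase.2 ⟨fun e => hxm (e ▸ hy.2), hy.1⟩
      have hce : (F.erase x).card = 2 := by rw [Finset.card_erase_of_mem hx, hc]
      have heq : F ∩ Finset.Icc 1 m = F.erase x :=
        Finset.eq_of_subset_of_card_le hsub (by omega)
      refine Finset.mem_image.2 ⟨(F.erase x, x), ?_, Finset.insert_erase hx⟩
      rw [Finset.mem_product, Finset.mem_powersetCard]
      refine ⟨⟨heq ▸ Finset.inter_subset_right, hce⟩, ?_⟩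
      have := Finset.mem_Icc.1 (hF hx)
      rw [Finset.mem_Icc] at hxm ⊢
      omega
  refine (Finset.card_le_card h).trans ((Finset.card_union_le _ _).trans ?_)
  refine Nat.add_le_add (by simp) (Finset.card_image_le.trans ?_)
  rw [Finset.card_product, Finset.card_powersetCard, Nat.card_Icc, Nat.card_Icc]
  rw [Nat.add_sub_cancel, Nat.add_sub_add_right]

/-- A `3`-set with at least three elements in `[m]` is contained in `[m]`. -/
theorem card_filter_three_le_card_inter_le (m n : ℕ) :
    ((Finset.powersetCard 3 (Finset.Icc 1 n)).filter
      fun F => 3 ≤ (F ∩ Finset.Icc 1 m).card).card ≤ m.choose 3 := by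
  have h : ((Finset.powersetCard 3 (Finset.Icc 1 n)).filter
      fun F => 3 ≤ (F ∩ Finset.Icc 1 m).card) ⊆ Finset.powersetCard 3 (Finset.Icc 1 m) := by
    intro F hF
    simp only [Finset.mem_filter, Finset.mem_powersetCard] at hF ⊢
    refine ⟨?_, hF.1.2⟩
    rw [← Finset.eq_of_subset_of_card_le (Finset.inter_subset_left (s₂ := Finset.Icc 1 m))
      (hF.1.2.trans_le hF.2)]
    exact Finset.inter_subset_right
  simpa using Finset.card_le_card h

theorem choose_three_add_choose_two_mul_le_max (s n : ℕ) (hs : 1 ≤ s) (hn : 3 * s + 2 ≤ n) :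
    (2 * s + 1).choose 3 + (2 * s + 1).choose 2 * (n - (2 * s + 1)) ≤
      max (n.choose 3 - (n - s).choose 3) ((3 * s + 2).choose 3) := by
  obtain ⟨t, rfl⟩ := Nat.exists_eq_add_of_le hn
  obtain ⟨r, rfl⟩ := Nat.exists_eq_add_of_le' hs
  have e₁ : 3 * (r + 1) + 2 + t - (2 * (r + 1) + 1) = r + t + 2 := by omega
  have e₂ : 3 * (r + 1) + 2 + t - (r + 1) = 2 * r + t + 2 + 2 := by omega
  have e₃ : 3 * (r + 1) + 2 + t = 3 * r + 3 + t + 2 := by omega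
  have e₄ : 2 * (r + 1) + 1 = 2 * r + 1 + 2 := by omega
  rw [e₁, e₂, e₃, e₄]
  have h₁ := Nat.six_mul_choose_three (2 * r + 1)
  have h₂ := Nat.two_mul_choose_two (2 * r + 2)
  have h₃ := Nat.six_mul_choose_three (2 * r + t + 2)
  have h₄ := Nat.six_mul_choose_three (3 * r + 3 + t)
  have h₅ := Nat.six_mul_choose_three (3 * (r + 1))
  rw [le_max_iff]
  rcases Nat.lt_or_ge (2 * t) (r + 2) with ht | ht
  · right
    generalize (2 * r + 1 + 2).choose 3 = a at *
    generalize (2 * r + 1 + 2).choose 2 = b at *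
    generalize (3 * (r + 1) + 2).choose 3 = c at *
    nlinarith [Nat.mul_le_mul_left ((r + 1) * (2 * r + 3)) (show 2 * t ≤ r + 1 by omega)]
  · left
    apply Nat.le_sub_of_add_le
    generalize (2 * r + 1 + 2).choose 3 = a at *
    generalize (2 * r + 1 + 2).choose 2 = b at *
    generalize (2 * r + t + 2 + 2).choose 3 = c at *
    generalize (3 * r + 3 + t + 2).choose 3 = d at *
    have hquad : (r + 2) * (r + 3) ≤ 3 * t * (r + 1 + t) := by nlinarith
    nlinarith [Nat.mul_le_mul_left (r + 1) hquad]


/-- For `k = 3`, `s ≥ 1`, `n ≥ 3s+2` and `1 ≤ ℓ ≤ 3`, the size of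
`𝓐_ℓ(n) = { F ∈ ([n] choose 3) : |F ∩ [ℓs+ℓ−1]| ≥ ℓ }` is at most
`max { C(n,3) − C(n−s,3), C(3s+2,3) }`. -/
theorem A_ell_card_bound (s ℓ n : ℕ) (hs : 1 ≤ s) (hn : 3 * s + 2 ≤ n)
    (hl1 : 1 ≤ ℓ) (hl3 : ℓ ≤ 3) :
    ((Finset.powersetCard 3 (Finset.Icc 1 n)).filter
      fun F => ℓ ≤ (F ∩ Finset.Icc 1 (ℓ * s + ℓ - 1)).card).card ≤
    max (n.choose 3 - (n - s).choose 3) ((3 * s + 2).choose 3) := by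
  obtain rfl | rfl | rfl : ℓ = 1 ∨ ℓ = 2 ∨ ℓ = 3 := by omega
  · rw [show 1 * s + 1 - 1 = s by omega, card_filter_one_le_card_inter]
    exact le_max_left _ _
  · rw [show 2 * s + 2 - 1 = 2 * s + 1 by omega]
    exact (card_filter_two_le_card_inter_le _ n).trans
      (choose_three_add_choose_two_mul_le_max s n hs hn)
  · rw [show 3 * s + 3 - 1 = 3 * s + 2 by omega]
    exact (card_filter_three_le_card_inter_le _ n).trans (le_max_right _ _)
end
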